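/- There is a constant b₀ > 0 such that the following holds for every λ > 0 and every finite connected transitive graph 𝔾: if the triangle condition ∇_{p_c}(x,y) ≤ δ_{x,y} + a₀ holds for some a₀ ≤ b₀, λV^{1/3} ≥ b₀^{-1}, and p = p_c − Ω^{-1}ε with ε ≥ 0 (and p ≥ 0), then (i) 10^{-4}·χ(p)² ≤ 𝔼_p|C_max| ≤ 2χ(p)²·log(V/χ(p)³); (ii) ℙ_p(|C_max| ≤ 2χ(p)²·log(V/χ(p)³)) ≥ 1 − √e/(2log(V/χ(p)³))^{3/2}; and (iii) for every ω ≥ 1, ℙ_p(|C_max| ≥ χ(p)²/(3600ω)) ≥ (1 + 36χ(p)³/(ωV))^{-1}. -/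

import Mathlib

noncomputable section
open Classical

namespace Percolation

variable {V : Type*} [Fintype V] [DecidableEq V]

/-- A percolation configuration: an assignment of occupied (`true`) or
vacant (`false`) to each bond of the graph. -/
def Config (G : SimpleGraph V) : Type _ := G.edgeSet → Bool

noncomputable instance (G : SimpleGraph V) : Fintype G.edgeSet :=
  Fintype.ofFinite _

noncomputable instance (G : SimpleGraph V) : Fintype (Config G) :=
  inferInstanceAs (Fintype (G.edgeSet → Bool))

/-- The probability weight of a configuration under the product Bernoulli
measure with parameter `p`. -/
def weight (G : SimpleGraph V) (p : ℝ) (ω : Config G) : ℝ :=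
  ∏ e : G.edgeSet, if ω e then p else 1 - p

/-- The probability of an event under the percolation measure `ℙ_p`. -/
def prob (G : SimpleGraph V) (p : ℝ) (A : Config G → Prop) : ℝ :=
  ∑ ω : Config G, if A ω then weight G p ω else 0

/-- The expectation of a random variable under the percolation measure `ℙ_p`. -/
def expect (G : SimpleGraph V) (p : ℝ) (f : Config G → ℝ) : ℝ :=
  ∑ ω : Config G, weight G p ω * f ω

/-- The subgraph consisting of the occupied bonds of a configuration. -/
def occupied (G : SimpleGraph V) (ω : Config G) : SimpleGraph V :=
  SimpleGraph.fromEdgeSet {e | ∃ h : e ∈ G.edgeSet, ω ⟨e, h⟩ = true}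

/-- The cluster `C(x)` of the vertex `x`: all vertices joined to `x` by a path
of occupied bonds (including `x` itself). -/
def cluster (G : SimpleGraph V) (ω : Config G) (x : V) : Finset V :=
  Finset.univ.filter fun y => (occupied G ω).Reachable x y

/-- The susceptibility `χ(p)`: the expected size of the cluster of `x₀`. -/
def chi (G : SimpleGraph V) (x₀ : V) (p : ℝ) : ℝ :=
  expect G p fun ω => ((cluster G ω x₀).card : ℝ)

/-- The two-point function `τ_p(x,y) = ℙ_p(x ↔ y)`. -/
def tau (G : SimpleGraph V) (p : ℝ) (x y : V) : ℝ :=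
  prob G p fun ω => (occupied G ω).Reachable x y

/-- The triangle diagram `∇_p(x,y)`. -/
def triangle (G : SimpleGraph V) (p : ℝ) (x y : V) : ℝ :=
  ∑ u : V, ∑ v : V, tau G p x u * tau G p u v * tau G p v y

/-- The Kronecker delta `δ_{x,y}`. -/
def kron (x y : V) : ℝ := if x = y then 1 else 0

/-- `∇̄_p`: the maximum of the triangle diagram over bonds `{x,y} ∈ 𝔹`. -/
def nablaBar (G : SimpleGraph V) (p : ℝ) : ℝ :=
  sSup {t : ℝ | ∃ x y : V, G.Adj x y ∧ t = triangle G p x y}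

/-- A graph is (vertex-)transitive if any vertex can be mapped to any other
by a graph automorphism. -/
def IsTransitive (G : SimpleGraph V) : Prop :=
  ∀ x y : V, ∃ φ : G ≃g G, φ x = y

/-- The size `|C_max|` of the largest cluster. -/
def maxCluster (G : SimpleGraph V) (ω : Config G) : ℕ :=
  Finset.univ.sup fun x => (cluster G ω x).card

/-- The cluster size distribution `P_{≥k}(p) = ℙ_p(|C(x₀)| ≥ k)`. -/
def Pgeq (G : SimpleGraph V) (x₀ : V) (p : ℝ) (k : ℝ) : ℝ :=
  prob G p fun ω => k ≤ ((cluster G ω x₀).card : ℝ)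

/-- The magnetization `M(p,γ)`. -/
def magnetization (G : SimpleGraph V) (x₀ : V) (p γ : ℝ) : ℝ :=
  ∑ k ∈ Finset.Icc 1 (Fintype.card V),
    (1 - (1 - γ) ^ k) * prob G p fun ω => (cluster G ω x₀).card = k

/-- `Z_{≥s}`: the number of vertices lying in clusters of size at least `s`. -/
def Zgeq (G : SimpleGraph V) (s : ℝ) (ω : Config G) : ℝ :=
  ∑ x : V, if s ≤ ((cluster G ω x).card : ℝ) then (1 : ℝ) else 0

/-- The variance of a random variable under `ℙ_p`. -/
def variance (G : SimpleGraph V) (p : ℝ) (f : Config G → ℝ) : ℝ :=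
  expect G p (fun ω => f ω ^ 2) - (expect G p f) ^ 2

/-- The restricted susceptibility `χ_{≥s}(p) = 𝔼_p[|C(x₀)| I[|C(x₀)| ≥ s]]`. -/
def chiGeq (G : SimpleGraph V) (x₀ : V) (p : ℝ) (s : ℝ) : ℝ :=
  expect G p fun ω =>
    if s ≤ ((cluster G ω x₀).card : ℝ) then ((cluster G ω x₀).card : ℝ) else 0

/-- The restricted susceptibility `χ_{<s}(p) = 𝔼_p[|C(x₀)| I[|C(x₀)| < s]]`. -/
def chiLt (G : SimpleGraph V) (x₀ : V) (p : ℝ) (s : ℝ) : ℝ :=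
  expect G p fun ω =>
    if ((cluster G ω x₀).card : ℝ) < s then ((cluster G ω x₀).card : ℝ) else 0

end Percolation

set_option linter.unusedSectionVars false
set_option linter.unusedVariables false


namespace PercAux

/-- indicator -/
def ind (P : Prop) : ℝ := if P then 1 else 0

lemma ind_true {P : Prop} (h : P) : ind P = 1 := if_pos h
lemma ind_false {P : Prop} (h : ¬ P) : ind P = 0 := if_neg h
lemma ind_nonneg (P : Prop) : 0 ≤ ind P := by unfold ind; split_ifs <;> norm_num
lemma ind_le_one (P : Prop) : ind P ≤ 1 := by unfold ind; split_ifs <;> norm_num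
lemma ind_mono {P Q : Prop} (h : P → Q) : ind P ≤ ind Q := by
  by_cases hP : P
  · rw [ind_true hP, ind_true (h hP)]
  · rw [ind_false hP]; exact ind_nonneg _
lemma ind_congr {P Q : Prop} (h : P ↔ Q) : ind P = ind Q :=
  le_antisymm (ind_mono h.1) (ind_mono h.2)
lemma ind_and (P Q : Prop) : ind (P ∧ Q) = ind P * ind Q := by
  unfold ind; split_ifs <;> simp_all

section abs
variable {α : Type*} [DecidableEq α]

/-- weight of `K` on `S` -/
def wtS (p : ℝ) (S K : Finset α) : ℝ := ∏ e ∈ S, if e ∈ K then p else 1 - p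

/-- expectation over subsets of `S` -/
def PES (p : ℝ) (S : Finset α) (f : Finset α → ℝ) : ℝ := ∑ K ∈ S.powerset, wtS p S K * f K

lemma wtS_nonneg {p : ℝ} (h0 : 0 ≤ p) (h1 : p ≤ 1) (S K : Finset α) : 0 ≤ wtS p S K := by
  apply Finset.prod_nonneg
  intro e _
  split_ifs <;> linarith

lemma PES_empty (p : ℝ) (f : Finset α → ℝ) : PES p ∅ f = f ∅ := by
  simp [PES, wtS]

lemma PES_insert (p : ℝ) {S : Finset α} {e : α} (he : e ∉ S) (f : Finset α → ℝ) :
    PES p (insert e S) f = p * PES p S (fun K => f (insert e K)) + (1 - p) * PES p S f := by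
  unfold PES
  rw [Finset.sum_powerset_insert he, add_comm, Finset.mul_sum, Finset.mul_sum]
  congr 1
  · apply Finset.sum_congr rfl
    intro K hK
    have hKS := Finset.mem_powerset.1 hK
    have : wtS p (insert e S) (insert e K) = p * wtS p S K := by
      unfold wtS
      rw [Finset.prod_insert he]
      simp only [Finset.mem_insert_self, if_true]
      congr 1
      apply Finset.prod_congr rfl
      intro x hx
      have : x ≠ e := fun h => he (h ▸ hx)
      simp [this]
    rw [this]; ring
  · apply Finset.sum_congr rfl
    intro K hK
    have hKS := Finset.mem_powerset.1 hK
    have : wtS p (insert e S) K = (1 - p) * wtS p S K := by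
      unfold wtS
      rw [Finset.prod_insert he]
      rw [if_neg (fun h => he (hKS h))]
    rw [this]; ring

lemma PES_mono {p : ℝ} (h0 : 0 ≤ p) (h1 : p ≤ 1) (S : Finset α) {f g : Finset α → ℝ}
    (h : ∀ K, f K ≤ g K) : PES p S f ≤ PES p S g :=
  Finset.sum_le_sum fun K _ => mul_le_mul_of_nonneg_left (h K) (wtS_nonneg h0 h1 S K)

lemma PES_add (p : ℝ) (S : Finset α) (f g : Finset α → ℝ) :
    PES p S (fun K => f K + g K) = PES p S f + PES p S g := by
  simp [PES, mul_add, Finset.sum_add_distrib]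

/-- monotonicity in `p` -/
lemma PES_mono_p {p q : ℝ} (h0 : 0 ≤ p) (hpq : p ≤ q) (h1 : q ≤ 1) (S : Finset α)
    (f : Finset α → ℝ) (hf : ∀ K L, K ⊆ L → f K ≤ f L) : PES p S f ≤ PES q S f := by
  induction S using Finset.induction_on generalizing f with
  | empty => simp [PES_empty]
  | insert e S he ih =>
    rw [PES_insert p he, PES_insert q he]
    have a1 := ih (fun K => f (insert e K)) (fun K L h => hf _ _ (Finset.insert_subset_insert e h))
    have a0 := ih f hf
    have a2 : PES p S f ≤ PES p S (fun K => f (insert e K)) :=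
      PES_mono h0 (hpq.trans h1) S fun K => hf _ _ (Finset.subset_insert e K)
    nlinarith

/-- upward closed families -/
def Up (A : Finset α → Prop) : Prop := ∀ K L, K ⊆ L → A K → A L

/-- disjoint occurrence -/
def dj (A B : Finset α → Prop) (K : Finset α) : Prop :=
  ∃ K₁ K₂, K₁ ⊆ K ∧ K₂ ⊆ K ∧ Disjoint K₁ K₂ ∧ A K₁ ∧ B K₂

lemma dj_up (A B : Finset α → Prop) : Up (dj A B) := by
  rintro K L h ⟨K₁, K₂, h1, h2, h3⟩
  exact ⟨K₁, K₂, h1.trans h, h2.trans h, h3⟩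

lemma dj_mono {A B A' B' : Finset α → Prop} (hA : ∀ K, A K → A' K) (hB : ∀ K, B K → B' K)
    (K : Finset α) (h : dj A B K) : dj A' B' K := by
  obtain ⟨K₁, K₂, h1, h2, h3, h4, h5⟩ := h
  exact ⟨K₁, K₂, h1, h2, h3, hA _ h4, hB _ h5⟩

lemma dj_insert {A B : Finset α → Prop} {e : α} {K : Finset α}
    (h : dj A B (insert e K)) (hA : Up A) (hB : Up B) :
    dj (fun L => A (insert e L)) B K ∨ dj A (fun L => B (insert e L)) K := by
  obtain ⟨K₁, K₂, h1, h2, h3, h4, h5⟩ := h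
  by_cases he : e ∈ K₁
  · left
    have he2 : e ∉ K₂ := fun h => (Finset.disjoint_left.1 h3 he h)
    refine ⟨K₁.erase e, K₂, ?_, ?_, ?_, ?_, h5⟩
    · intro x hx
      have := h1 (Finset.mem_of_mem_erase hx)
      rcases Finset.mem_insert.1 this with h | h
      · exact absurd h (Finset.ne_of_mem_erase hx)
      · exact h
    · intro x hx
      rcases Finset.mem_insert.1 (h2 hx) with h | h
      · exact absurd (h ▸ hx) he2
      · exact h
    · exact h3.mono_left (Finset.erase_subset _ _)
    · simpa [Finset.insert_erase he] using h4
  · right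
    refine ⟨K₁, K₂.erase e, ?_, ?_, ?_, h4, ?_⟩
    · intro x hx
      rcases Finset.mem_insert.1 (h1 hx) with h | h
      · exact absurd (h ▸ hx) he
      · exact h
    · intro x hx
      have := h2 (Finset.mem_of_mem_erase hx)
      rcases Finset.mem_insert.1 this with h | h
      · exact absurd h (Finset.ne_of_mem_erase hx)
      · exact h
    · exact h3.mono_right (Finset.erase_subset _ _)
    · exact hB _ _ (by intro x hx; by_cases h : x = e <;> simp [h, hx]) h5

/-- The van den Berg and Kesten inequality for increasing events. -/
lemma BK_S {p : ℝ} (h0 : 0 ≤ p) (h1 : p ≤ 1) (S : Finset α) (A B : Finset α → Prop)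
    (hA : Up A) (hB : Up B) :
    PES p S (fun K => ind (dj A B K)) ≤
      PES p S (fun K => ind (A K)) * PES p S (fun K => ind (B K)) := by
  induction S using Finset.induction_on generalizing A B with
  | empty =>
    simp only [PES_empty]
    rw [← ind_and]
    apply ind_mono
    rintro ⟨K₁, K₂, k1, k2, -, hA', hB'⟩
    exact ⟨hA _ _ k1 hA', hB _ _ k2 hB'⟩
  | insert e S he ih =>
    rw [PES_insert p he, PES_insert p he, PES_insert p he]
    set A1 : Finset α → Prop := fun L => A (insert e L) with hA1
    set B1 : Finset α → Prop := fun L => B (insert e L) with hB1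
    have uA1 : Up A1 := fun K L h => hA _ _ (Finset.insert_subset_insert e h)
    have uB1 : Up B1 := fun K L h => hB _ _ (Finset.insert_subset_insert e h)
    have i00 := ih A B hA hB
    have i01 := ih A B1 hA uB1
    have i10 := ih A1 B uA1 hB
    have i11 := ih A1 B1 uA1 uB1
    have AA1 : ∀ K, A K → A1 K := fun K h => hA _ _ (Finset.subset_insert e K) h
    have BB1 : ∀ K, B K → B1 K := fun K h => hB _ _ (Finset.subset_insert e K) h
    set U := PES p S (fun K => ind (dj A B (insert e K))) with hU
    have u1 : U ≤ PES p S (fun K => ind (dj A1 B1 K)) := by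
      apply PES_mono h0 h1
      intro K
      apply ind_mono
      intro h
      rcases dj_insert h hA hB with h | h
      · exact dj_mono (fun _ h => h) BB1 K h
      · exact dj_mono AA1 (fun _ h => h) K h
    have u2 : PES p S (fun K => ind (dj A B K)) + U ≤
        PES p S (fun K => ind (dj A B1 K)) + PES p S (fun K => ind (dj A1 B K)) := by
      rw [hU, ← PES_add, ← PES_add]
      apply PES_mono h0 h1
      intro K
      have m1 : dj A B K → dj A B1 K := dj_mono (fun _ h => h) BB1 K
      have m2 : dj A B K → dj A1 B K := dj_mono AA1 (fun _ h => h) K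
      have m3 : dj A B (insert e K) → dj A1 B K ∨ dj A B1 K := fun h => dj_insert h hA hB
      have m4 : dj A B K → dj A B (insert e K) := dj_up A B _ _ (Finset.subset_insert e K)
      simp only [ind]
      split_ifs <;> first | (norm_num; done) | (exfalso; tauto)
    simp only [hA1, hB1] at *
    nlinarith [mul_nonneg h0 (sub_nonneg.2 h1), mul_nonneg h0 h0,
      mul_nonneg (sub_nonneg.2 h1) (sub_nonneg.2 h1),
      mul_le_mul_of_nonneg_left i00 (mul_nonneg (sub_nonneg.2 h1) (sub_nonneg.2 h1)),
      mul_le_mul_of_nonneg_left (i01.trans le_rfl) (mul_nonneg h0 (sub_nonneg.2 h1)),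
      mul_le_mul_of_nonneg_left (i10.trans le_rfl) (mul_nonneg h0 (sub_nonneg.2 h1)),
      mul_le_mul_of_nonneg_left u2 (mul_nonneg h0 (sub_nonneg.2 h1)),
      mul_le_mul_of_nonneg_left (u1.trans i11) (mul_nonneg h0 h0)]

variable [Fintype α]

/-- expectation over all subsets -/
def PE (p : ℝ) (f : Finset α → ℝ) : ℝ := PES p Finset.univ f

lemma PE_eq (p : ℝ) (f : Finset α → ℝ) :
    PE p f = ∑ K : Finset α, wtS p Finset.univ K * f K := by
  unfold PE PES
  rw [Finset.powerset_univ]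

lemma PE_add (p : ℝ) (f g : Finset α → ℝ) : PE p (fun K => f K + g K) = PE p f + PE p g :=
  PES_add p _ f g

lemma PE_sum {ι : Type*} (p : ℝ) (s : Finset ι) (f : ι → Finset α → ℝ) :
    PE p (fun K => ∑ i ∈ s, f i K) = ∑ i ∈ s, PE p (f i) := by
  simp only [PE_eq, Finset.mul_sum]
  rw [Finset.sum_comm]

lemma PE_mul_left (p c : ℝ) (f : Finset α → ℝ) : PE p (fun K => c * f K) = c * PE p f := by
  simp only [PE_eq, Finset.mul_sum]
  apply Finset.sum_congr rfl; intros; ring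

lemma PE_mul_right (p c : ℝ) (f : Finset α → ℝ) : PE p (fun K => f K * c) = PE p f * c := by
  simp only [PE_eq, Finset.sum_mul]
  apply Finset.sum_congr rfl; intros; ring

lemma PE_neg (p : ℝ) (f : Finset α → ℝ) : PE p (fun K => - f K) = - PE p f := by
  simp [PE_eq]

lemma PE_sub (p : ℝ) (f g : Finset α → ℝ) : PE p (fun K => f K - g K) = PE p f - PE p g := by
  simp [PE_eq, mul_sub, Finset.sum_sub_distrib]

lemma PE_mono {p : ℝ} (h0 : 0 ≤ p) (h1 : p ≤ 1) {f g : Finset α → ℝ}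
    (h : ∀ K, f K ≤ g K) : PE p f ≤ PE p g := PES_mono h0 h1 _ h

lemma PES_one (p : ℝ) (S : Finset α) : PES p S (fun _ => 1) = 1 := by
  induction S using Finset.induction_on with
  | empty => simp [PES_empty]
  | insert e S he ih => rw [PES_insert p he, ih]; ring

lemma PE_const (p c : ℝ) : PE (α := α) p (fun _ => c) = c := by
  have := PE_mul_right (α := α) p c (fun _ => 1)
  simp only [one_mul] at this
  rw [this, PE, PES_one, one_mul]

lemma PE_nonneg {p : ℝ} (h0 : 0 ≤ p) (h1 : p ≤ 1) {f : Finset α → ℝ}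
    (h : ∀ K, 0 ≤ f K) : 0 ≤ PE p f := by
  have := PE_mono h0 h1 h
  rwa [PE_const] at this

lemma PE_mono_p {p q : ℝ} (h0 : 0 ≤ p) (hpq : p ≤ q) (h1 : q ≤ 1)
    (f : Finset α → ℝ) (hf : ∀ K L, K ⊆ L → f K ≤ f L) : PE p f ≤ PE q f :=
  PES_mono_p h0 hpq h1 _ f hf

lemma BK {p : ℝ} (h0 : 0 ≤ p) (h1 : p ≤ 1) (A B : Finset α → Prop)
    (hA : Up A) (hB : Up B) :
    PE p (fun K => ind (dj A B K)) ≤ PE p (fun K => ind (A K)) * PE p (fun K => ind (B K)) :=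
  BK_S h0 h1 _ A B hA hB

lemma PE_resample (p : ℝ) (e : α) (f : Finset α → ℝ) :
    PE p f = PE p (fun K => p * f (insert e K) + (1 - p) * f (K.erase e)) := by
  have hu : (Finset.univ : Finset α) = insert e (Finset.univ.erase e) := by simp
  unfold PE
  rw [hu, PES_insert p (by simp), PES_insert p (by simp)]
  have h1 : PES p (Finset.univ.erase e)
      (fun K => p * f (insert e (insert e K)) + (1 - p) * f ((insert e K).erase e)) =
      p * PES p (Finset.univ.erase e) (fun K => f (insert e K)) +
      (1 - p) * PES p (Finset.univ.erase e) f := by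
    unfold PES
    rw [Finset.mul_sum, Finset.mul_sum, ← Finset.sum_add_distrib]
    apply Finset.sum_congr rfl
    intro K hK
    have : e ∉ K := fun h => by simpa using Finset.mem_powerset.1 hK h
    simp only [Finset.insert_idem, Finset.erase_insert this]
    ring
  have h2 : PES p (Finset.univ.erase e)
      (fun K => p * f (insert e K) + (1 - p) * f (K.erase e)) =
      p * PES p (Finset.univ.erase e) (fun K => f (insert e K)) +
      (1 - p) * PES p (Finset.univ.erase e) f := by
    unfold PES
    rw [Finset.mul_sum, Finset.mul_sum, ← Finset.sum_add_distrib]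
    apply Finset.sum_congr rfl
    intro K hK
    have : e ∉ K := fun h => by simpa using Finset.mem_powerset.1 hK h
    simp only [Finset.erase_eq_of_notMem this]
    ring
  rw [h1, h2]; ring

/-- keep the first set on `S`, use the second off `S` -/
def mix (S K K' : Finset α) : Finset α := (K ∩ S) ∪ (K' \ S)

lemma mem_mix {S K K' : Finset α} {e : α} :
    e ∈ mix S K K' ↔ (e ∈ S ∧ e ∈ K) ∨ (e ∉ S ∧ e ∈ K') := by
  simp only [mix, Finset.mem_union, Finset.mem_inter, Finset.mem_sdiff]; tauto

/-- exchange of two independent configurations off a stopping set -/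
lemma PE_swap (p : ℝ) (S : Finset α → Finset α)
    (hS : ∀ K K', S (mix (S K) K K') = S K) (g : Finset α → Finset α → ℝ) :
    PE p (fun K => PE p (fun K' => g K K')) =
      PE p (fun K => PE p (fun K' => g (mix (S K) K K') (mix (S K) K' K))) := by
  simp only [PE_eq, Finset.mul_sum]
  rw [← Fintype.sum_prod_type', ← Fintype.sum_prod_type']
  let T : Finset α × Finset α → Finset α × Finset α :=
    fun x => (mix (S x.1) x.1 x.2, mix (S x.1) x.2 x.1)
  have hT : Function.Involutive T := by
    rintro ⟨K, K'⟩
    simp only [T, hS]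
    ext e <;> simp only [mem_mix] <;> tauto
  rw [← Equiv.sum_comp (hT.toPerm T)]
  apply Finset.sum_congr rfl
  rintro ⟨K, K'⟩ _
  simp only [Function.Involutive.coe_toPerm, T, ← mul_assoc]
  congr 1
  simp only [wtS, ← Finset.prod_mul_distrib]
  apply Finset.prod_congr rfl
  intro e _
  simp only [mem_mix]
  by_cases h1 : e ∈ S K
  · simp [h1]
  · simp [h1, mul_comm]

end abs
end PercAux


namespace PercAux
open Percolation

section graph
variable {V : Type*} [Fintype V] [DecidableEq V] {G : SimpleGraph V}

/-- configuration with occupied set `K` -/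
def cfg (K : Finset G.edgeSet) : Config G := fun e => decide (e ∈ K)

/-- connection in `K` -/
def Cn (K : Finset G.edgeSet) (x y : V) : Prop := (occupied G (cfg K)).Reachable x y

lemma adj_iff {K : Finset G.edgeSet} {x y : V} :
    (occupied G (cfg K)).Adj x y ↔ ∃ h : G.Adj x y, (⟨s(x, y), h⟩ : G.edgeSet) ∈ K := by
  unfold occupied cfg
  rw [SimpleGraph.fromEdgeSet_adj]
  constructor
  · rintro ⟨⟨h, h2⟩, h3⟩
    exact ⟨h, by simpa using h2⟩
  · rintro ⟨h, h2⟩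
    exact ⟨⟨h, by simpa using h2⟩, h.ne⟩

lemma Cn.refl (K : Finset G.edgeSet) (x : V) : Cn K x x := SimpleGraph.Reachable.refl x
lemma Cn.symm {K : Finset G.edgeSet} {x y : V} (h : Cn K x y) : Cn K y x :=
  SimpleGraph.Reachable.symm h
lemma Cn.trans {K : Finset G.edgeSet} {x y z : V} (h : Cn K x y) (h' : Cn K y z) : Cn K x z :=
  SimpleGraph.Reachable.trans h h'
lemma Cn_edge {K : Finset G.edgeSet} {x y : V} (h : G.Adj x y)
    (he : (⟨s(x, y), h⟩ : G.edgeSet) ∈ K) : Cn K x y :=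
  (adj_iff.2 ⟨h, he⟩).reachable
lemma Cn_comm {K : Finset G.edgeSet} {x y : V} : Cn K x y ↔ Cn K y x :=
  ⟨Cn.symm, Cn.symm⟩

lemma Cn_ind {K : Finset G.edgeSet} {x : V} (P : V → Prop) (hx : P x)
    (step : ∀ w w' (h : G.Adj w w'), (⟨s(w, w'), h⟩ : G.edgeSet) ∈ K → P w → P w') {y : V}
    (h : Cn K x y) : P y := by
  unfold Cn at h
  rw [SimpleGraph.reachable_iff_reflTransGen] at h
  induction h with
  | refl => exact hx
  | tail _ h2 ih =>
    obtain ⟨h3, h4⟩ := adj_iff.1 h2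
    exact step _ _ h3 h4 ih

lemma Cn.mono {K L : Finset G.edgeSet} (hKL : K ⊆ L) {x y : V} (h : Cn K x y) : Cn L x y :=
  Cn_ind (K := K) (fun w => Cn L x w) (Cn.refl _ _)
    (fun w w' h he hw => hw.trans (Cn_edge h (hKL he))) h

lemma Cn_up (x y : V) : Up (fun K : Finset G.edgeSet => Cn K x y) := fun _ _ h hK => hK.mono h

/-- the edge `e` touches the cluster of `x` -/
def touch (K : Finset G.edgeSet) (x : V) (e : G.edgeSet) : Prop := ∃ w ∈ e.1, Cn K x w

/-- all edges touching the cluster -/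
def tset (K : Finset G.edgeSet) (x : V) : Finset G.edgeSet :=
  Finset.univ.filter (fun e => touch K x e)

lemma mem_tset {K : Finset G.edgeSet} {x : V} {e : G.edgeSet} :
    e ∈ tset K x ↔ touch K x e := by simp [tset]

lemma touch.mono {K L : Finset G.edgeSet} (hKL : K ⊆ L) {x : V} {e : G.edgeSet}
    (h : touch K x e) : touch L x e := by
  obtain ⟨w, hw, hc⟩ := h
  exact ⟨w, hw, hc.mono hKL⟩

lemma Cn_of_agree {K L : Finset G.edgeSet} {x y : V} (h : ∀ e ∈ L, touch K x e → e ∈ K)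
    (hc : Cn L x y) : Cn K x y :=
  Cn_ind (K := L) (fun w => Cn K x w) (Cn.refl _ _)
    (fun w w' ha he hw => hw.trans (Cn_edge ha (h _ he ⟨w, by simp, hw⟩))) hc

lemma Cn_local {K : Finset G.edgeSet} {x y : V} (hc : Cn K x y) : Cn (K ∩ tset K x) x y := by
  have := Cn_ind (K := K) (x := x) (fun w => Cn K x w ∧ Cn (K ∩ tset K x) x w)
    ⟨Cn.refl _ _, Cn.refl _ _⟩
    (fun w w' ha he hw => ⟨hw.1.trans (Cn_edge ha he), hw.2.trans (Cn_edge ha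
      (Finset.mem_inter.2 ⟨he, mem_tset.2 ⟨w, by simp, hw.1⟩⟩))⟩) hc
  exact this.2

lemma touch_of_Cn_iff {K L : Finset G.edgeSet} {x : V} (h : ∀ w, Cn K x w ↔ Cn L x w)
    (e : G.edgeSet) : touch K x e ↔ touch L x e := by
  unfold touch; simp only [h]

lemma Cn_insert_of_not_touch {K : Finset G.edgeSet} {x : V} {e : G.edgeSet}
    (h : ¬ touch K x e) (w : V) : Cn (insert e K) x w ↔ Cn K x w := by
  constructor
  · apply Cn_of_agree
    intro f hf ht
    rcases Finset.mem_insert.1 hf with rfl | hf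
    · exact absurd ht h
    · exact hf
  · exact Cn.mono (Finset.subset_insert _ _)

lemma touch_insert {K : Finset G.edgeSet} {x : V} {e : G.edgeSet} :
    touch (insert e K) x e ↔ touch K x e := by
  constructor
  · intro h
    by_contra hn
    exact hn ((touch_of_Cn_iff (Cn_insert_of_not_touch hn) e).1 h)
  · exact touch.mono (Finset.subset_insert _ _)

lemma touch_erase {K : Finset G.edgeSet} {x : V} {e : G.edgeSet} :
    touch (K.erase e) x e ↔ touch K x e := by
  rw [← touch_insert]
  constructor
  · intro h
    by_cases he : e ∈ K
    · rwa [Finset.insert_erase he] at h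
    · rw [Finset.erase_eq_of_notMem he] at h; exact touch_insert.1 h
  · intro h
    exact h.mono (by intro x hx; by_cases h : x = e <;> simp [h, hx])

lemma Cn_mix {K K' : Finset G.edgeSet} {x : V} (w : V) :
    Cn (mix (tset K x) K K') x w ↔ Cn K x w := by
  constructor
  · apply Cn_of_agree
    intro e he ht
    rw [mem_mix] at he
    rcases he with he | he
    · exact he.2
    · exact absurd (mem_tset.2 ht) he.1
  · intro h
    exact (Cn_local h).mono Finset.subset_union_left

lemma tset_mix {K K' : Finset G.edgeSet} {x : V} :
    tset (mix (tset K x) K K') x = tset K x := by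
  ext e
  rw [mem_tset, mem_tset]
  exact touch_of_Cn_iff Cn_mix e

lemma tset_disj {K : Finset G.edgeSet} {u v : V} (h : ¬ Cn K u v) :
    Disjoint (K ∩ tset K u) (K ∩ tset K v) := by
  rw [Finset.disjoint_left]
  rintro ⟨e, heG⟩ h1 h2
  rw [Finset.mem_inter, mem_tset] at h1 h2
  obtain ⟨he, a, ha, hua⟩ := h1
  obtain ⟨-, b, hb, hvb⟩ := h2
  induction e using Sym2.ind with
  | _ c d =>
    have hcd : Cn K c d := Cn_edge heG he
    simp only [Sym2.mem_iff] at ha hb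
    rcases ha with rfl | rfl <;> rcases hb with rfl | rfl
    · exact h (hua.trans hvb.symm)
    · exact h (hua.trans (hcd.trans hvb.symm))
    · exact h (hua.trans (hcd.symm.trans hvb.symm))
    · exact h (hua.trans hvb.symm)

/-- all labels of `A` are connected to `u` -/
def allC {ι : Type*} (pos : ι → V) (u : V) (A : Finset ι) (K : Finset G.edgeSet) : Prop :=
  ∀ i ∈ A, Cn K u (pos i)

lemma allC_up {ι : Type*} (pos : ι → V) (u : V) (A : Finset ι) :
    Up (allC (G := G) pos u A) := fun _ _ h hK i hi => (hK i hi).mono h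

lemma Cn_erase_or {K : Finset G.edgeSet} {u v : V} (h : G.Adj u v) {x : V} (hx : Cn K u x) :
    Cn (K.erase ⟨s(u, v), h⟩) u x ∨ Cn (K.erase ⟨s(u, v), h⟩) v x := by
  refine Cn_ind (K := K) (fun w => Cn (K.erase ⟨s(u, v), h⟩) u w ∨ Cn (K.erase ⟨s(u, v), h⟩) v w)
    (Or.inl (Cn.refl _ _)) ?_ hx
  intro w w' ha he hw
  by_cases heq : (⟨s(w, w'), ha⟩ : G.edgeSet) = ⟨s(u, v), h⟩
  · have heq := congrArg Subtype.val heq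
    simp only [Sym2.eq_iff] at heq
    rcases heq with ⟨rfl, rfl⟩ | ⟨rfl, rfl⟩
    · exact Or.inr (Cn.refl _ _)
    · exact Or.inl (Cn.refl _ _)
  · have := Cn_edge (K := K.erase ⟨s(u, v), h⟩) ha (Finset.mem_erase.2 ⟨heq, he⟩)
    exact hw.imp (fun h => h.trans this) (fun h => h.trans this)

lemma decomp {ι : Type*} [DecidableEq ι] (pos : ι → V) (X : Finset ι) (hX : 2 ≤ X.card)
    (K : Finset G.edgeSet) (a : V) (h : allC pos a X K) :
    ∃ u, ∃ A, A ⊆ X ∧ A.Nonempty ∧ A ≠ X ∧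
      dj (fun K => Cn K a u) (dj (allC pos u A) (allC pos u (X \ A))) K := by
  -- minimal choice
  have hex : ∃ n : ℕ, ∃ K₁ K₂ u, K₁ ⊆ K ∧ K₂ ⊆ K ∧ Disjoint K₁ K₂ ∧ Cn K₁ a u ∧
      allC pos u X K₂ ∧ K₂.card = n :=
    ⟨_, ∅, K, a, by simp, subset_rfl, by simp, Cn.refl _ _, h, rfl⟩
  obtain ⟨K₁, K₂, u, h1, h2, h3, h4, h5, h6⟩ := Nat.find_spec hex
  have hmin : ∀ K₁' K₂' u', K₁' ⊆ K → K₂' ⊆ K → Disjoint K₁' K₂' → Cn K₁' a u' →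
      allC pos u' X K₂' → K₂.card ≤ K₂'.card := by
    intro K₁' K₂' u' a1 a2 a3 a4 a5
    rw [h6]
    exact Nat.find_min' hex ⟨K₁', K₂', u', a1, a2, a3, a4, a5, rfl⟩
  clear h6
  by_cases hv : ∃ v, ∃ h : G.Adj u v, (⟨s(u, v), h⟩ : G.edgeSet) ∈ K₂
  · obtain ⟨v, ha, he⟩ := hv
    set e : G.edgeSet := ⟨s(u, v), ha⟩ with hedef
    set K₃ := K₂.erase e with hK3
    have hcard : K₃.card < K₂.card := Finset.card_erase_lt_of_mem he
    have hsub : K₃ ⊆ K₂ := Finset.erase_subset _ _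
    set B := X.filter (fun i => ¬ Cn K₃ u (pos i)) with hB
    have hBv : ∀ i ∈ B, Cn K₃ v (pos i) := by
      intro i hi
      rw [hB, Finset.mem_filter] at hi
      exact (Cn_erase_or ha (h5 i hi.1)).resolve_left hi.2
    have hBne : B.Nonempty := by
      rw [Finset.nonempty_iff_ne_empty]
      intro hBe
      have := hmin K₁ K₃ u h1 (hsub.trans h2) (h3.mono_right hsub) h4 (by
        intro i hi
        by_contra hc
        have : i ∈ B := Finset.mem_filter.2 ⟨hi, hc⟩
        rw [hBe] at this
        simp at this)
      omega
    have huv : ¬ Cn K₃ u v := by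
      obtain ⟨i, hi⟩ := hBne
      intro hc
      exact (Finset.mem_filter.1 hi).2 (hc.trans (hBv i hi))
    have hBX : B ≠ X := by
      intro hBX
      have := hmin (insert e K₁) K₃ v (Finset.insert_subset (h2 he) h1) (hsub.trans h2) (by
        rw [Finset.disjoint_insert_left]
        exact ⟨by simp [hK3], h3.mono_right hsub⟩)
        ((h4.mono (Finset.subset_insert _ _)).trans (Cn_edge ha (Finset.mem_insert_self _ _)))
        (by intro i hi; exact hBv i (hBX ▸ hi))
      omega
    refine ⟨u, B, Finset.filter_subset _ _, hBne, hBX, K₁, K₂, h1, h2, h3, h4, ?_⟩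
    refine ⟨insert e (K₃ ∩ tset K₃ v), K₃ ∩ tset K₃ u, ?_, ?_, ?_, ?_, ?_⟩
    · exact Finset.insert_subset he (Finset.inter_subset_left.trans hsub)
    · exact Finset.inter_subset_left.trans hsub
    · rw [Finset.disjoint_insert_left]
      exact ⟨by simp [hK3], (tset_disj huv).symm⟩
    · intro i hi
      exact (Cn_edge ha (Finset.mem_insert_self _ _)).trans
        ((Cn_local (hBv i hi)).mono (Finset.subset_insert _ _))
    · intro i hi
      rw [Finset.mem_sdiff, hB, Finset.mem_filter, not_and, not_not] at hi
      exact Cn_local (hi.2 hi.1)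
  · have hall : ∀ i ∈ X, pos i = u := by
      intro i hi
      refine Cn_ind (K := K₂) (fun w => w = u) rfl ?_ (h5 i hi)
      intro w w' ha he hw
      subst hw
      exact absurd ⟨w', ha, he⟩ hv
    have hne : X.Nonempty := Finset.card_pos.1 (by omega)
    obtain ⟨i, hi⟩ := hne
    refine ⟨u, {i}, by simpa using hi, by simp, ?_, K₁, ∅, h1, by simp, by simp, h4, ∅, ∅,
      by simp, by simp, by simp, ?_, ?_⟩
    · intro h; rw [← h] at hX; simp at hX
    · intro j hj
      rw [Finset.mem_singleton.1 hj, hall i hi]; exact Cn.refl _ _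
    · intro j hj
      rw [hall j (Finset.mem_sdiff.1 hj).1]; exact Cn.refl _ _

lemma walk_Cn {K : Finset G.edgeSet} {x y : V} (q : (occupied G (cfg K)).Walk x y) :
    Cn (K.filter (fun e => e.1 ∈ q.edges)) x y := by
  refine ⟨q.transfer _ ?_⟩
  intro e he
  have h1 := q.edges_subset_edgeSet he
  induction e using Sym2.ind with
  | _ c d =>
    obtain ⟨h2, h3⟩ := adj_iff.1 h1
    exact adj_iff.2 ⟨h2, by simp [h3, he]⟩

lemma path_split (P : V → Prop) {K : Finset G.edgeSet} {v x : V} (h : Cn K v x) :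
    (∃ w, P w ∧ dj (fun K => Cn K v w) (fun K => Cn K w x) K) ∨
      (¬ P v ∧ Cn (K.filter (fun e => ∀ w ∈ e.1, ¬ P w)) v x) := by
  obtain ⟨q, hq⟩ := h.exists_isPath
  by_cases hP : ∃ w ∈ q.support, P w
  · left
    obtain ⟨w, hw, hPw⟩ := hP
    refine ⟨w, hPw, _, _, Finset.filter_subset _ _, Finset.filter_subset _ _, ?_,
      walk_Cn (q.takeUntil w hw), walk_Cn (q.dropUntil w hw)⟩
    have hnd := hq.isTrail.edges_nodup
    rw [← q.take_spec hw, SimpleGraph.Walk.edges_append] at hnd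
    have := List.disjoint_of_nodup_append hnd
    rw [Finset.disjoint_left]
    intro e h1 h2
    exact this (Finset.mem_filter.1 h1).2 (Finset.mem_filter.1 h2).2
  · right
    push Not at hP
    refine ⟨hP v q.start_mem_support, (walk_Cn q).mono ?_⟩
    intro e he
    rw [Finset.mem_filter] at he ⊢
    refine ⟨he.1, fun w hw => hP w ?_⟩
    exact SimpleGraph.Walk.mem_support_of_mem_edges he.2 hw

lemma first_step {K : Finset G.edgeSet} {a y : V} (h : Cn K a y) :
    a = y ∨ ∃ v, ∃ h : G.Adj a v, (⟨s(a, v), h⟩ : G.edgeSet) ∈ K ∧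
      Cn (K.erase ⟨s(a, v), h⟩) v y := by
  refine Cn_ind (K := K) (fun w => a = w ∨ ∃ v, ∃ h : G.Adj a v, (⟨s(a, v), h⟩ : G.edgeSet) ∈ K ∧
      Cn (K.erase ⟨s(a, v), h⟩) v w) (Or.inl rfl) ?_ h
  intro w w' ha he hw
  rcases hw with rfl | ⟨v, hv, hvK, hc⟩
  · exact Or.inr ⟨w', ha, he, Cn.refl _ _⟩
  · by_cases haw' : a = w'
    · exact Or.inl haw'
    by_cases haw : a = w
    · subst haw
      exact Or.inr ⟨w', ha, he, Cn.refl _ _⟩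
    right
    refine ⟨v, hv, hvK, hc.trans (Cn_edge ha (Finset.mem_erase.2 ⟨?_, he⟩))⟩
    intro heq
    have heq := congrArg Subtype.val heq
    simp only [Sym2.eq_iff] at heq
    rcases heq with ⟨h, -⟩ | ⟨-, h⟩
    · exact haw h.symm
    · exact haw' h.symm

/-- cluster -/
def cl (K : Finset G.edgeSet) (x : V) : Finset V := cluster G (cfg K) x

lemma mem_cl {K : Finset G.edgeSet} {x y : V} : y ∈ cl K x ↔ Cn K x y := by
  simp [cl, cluster, Cn]

lemma cl_card (K : Finset G.edgeSet) (x : V) : ((cl K x).card : ℝ) = ∑ y, ind (Cn K x y) := by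
  have : cl K x = Finset.univ.filter (fun y => Cn K x y) := by ext; simp [mem_cl]
  rw [this, Finset.card_filter]
  push_cast
  rfl

lemma cl_pos (K : Finset G.edgeSet) (x : V) : 1 ≤ (cl K x).card :=
  Finset.card_pos.2 ⟨x, mem_cl.2 (Cn.refl _ _)⟩

lemma cl_mono {K L : Finset G.edgeSet} (h : K ⊆ L) (x : V) : cl K x ⊆ cl L x := fun y hy =>
  mem_cl.2 ((mem_cl.1 hy).mono h)

lemma cl_eq {K : Finset G.edgeSet} {x y : V} (h : Cn K x y) : cl K x = cl K y := by
  ext z; rw [mem_cl, mem_cl]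
  exact ⟨fun h' => h.symm.trans h', fun h' => h.trans h'⟩

/-- configurations as sets -/
def cfgEquiv : Finset G.edgeSet ≃ Config G where
  toFun := cfg
  invFun ω := Finset.univ.filter (fun e => ω e = true)
  left_inv K := by ext e; simp [cfg]
  right_inv ω := by funext e; simp [cfg]

lemma expect_eq (p : ℝ) (f : Config G → ℝ) : expect G p f = PE p (fun K => f (cfg K)) := by
  rw [PE_eq, expect, ← Equiv.sum_comp cfgEquiv]
  apply Finset.sum_congr rfl
  intro K _
  congr 1
  unfold weight wtS
  apply Finset.prod_congr rfl
  intro e _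
  change (if cfg K e = true then p else 1 - p) = _
  simp [cfg]

lemma prob_eq (p : ℝ) (A : Config G → Prop) : prob G p A = PE p (fun K => ind (A (cfg K))) := by
  rw [← expect_eq p (fun ω => ind (A ω)), prob, expect]
  apply Finset.sum_congr rfl
  intro ω _
  unfold ind
  split_ifs <;> simp

lemma chi_eq (x : V) (p : ℝ) : chi G x p = PE p (fun K => ((cl (G := G) K x).card : ℝ)) := by
  rw [chi, expect_eq]; rfl

lemma tau_eq (p : ℝ) (x y : V) : tau G p x y = PE p (fun K => ind (Cn (G := G) K x y)) := by
  rw [tau, prob_eq]; rfl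

lemma chi_eq_sum (x : V) (p : ℝ) : chi G x p = ∑ y, tau G p x y := by
  simp only [chi_eq, tau_eq, cl_card, PE_sum]

lemma tau_comm (p : ℝ) (x y : V) : tau G p x y = tau G p y x := by
  simp only [tau_eq]
  congr 1; funext K
  exact ind_congr Cn_comm

/-- automorphism action on edges -/
def edgeMap (φ : G ≃g G) : G.edgeSet ≃ G.edgeSet := φ.mapEdgeSet

lemma Cn_map (φ : G ≃g G) (K : Finset G.edgeSet) {x y : V} (h : Cn K x y) :
    Cn (K.map (edgeMap φ).toEmbedding) (φ x) (φ y) := by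
  refine Cn_ind (K := K) (fun w => Cn (K.map (edgeMap φ).toEmbedding) (φ x) (φ w))
    (Cn.refl _ _) ?_ h
  intro w w' ha he hw
  refine hw.trans (Cn_edge (φ.map_adj_iff.2 ha) ?_)
  rw [Finset.mem_map]
  exact ⟨_, he, rfl⟩

lemma Cn_map_iff (φ : G ≃g G) (K : Finset G.edgeSet) {x y : V} :
    Cn (K.map (edgeMap φ).toEmbedding) (φ x) (φ y) ↔ Cn K x y := by
  constructor
  · intro h
    have := Cn_map φ.symm _ h
    rw [Finset.map_map] at this
    simp only [RelIso.symm_apply_apply] at this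
    convert this
    ext e
    rw [Finset.mem_map]
    have : ∀ a, ((edgeMap φ).toEmbedding.trans (edgeMap φ.symm).toEmbedding) a = a := by
      intro a
      exact (edgeMap φ).symm_apply_apply a
    simp only [this, exists_eq_right]
  · exact Cn_map φ K

lemma PE_map (φ : G ≃g G) (p : ℝ) (f : Finset G.edgeSet → ℝ) :
    PE p (fun K => f (K.map (edgeMap φ).toEmbedding)) = PE p f := by
  symm
  rw [PE_eq, PE_eq, ← Equiv.sum_comp (Equiv.finsetCongr (edgeMap φ))]
  apply Finset.sum_congr rfl
  intro K _
  simp only [Equiv.finsetCongr_apply]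
  congr 1
  unfold wtS
  rw [← Equiv.prod_comp (edgeMap φ)]
  apply Finset.prod_congr rfl
  intro e _
  simp

lemma PE_cl_transitive (hG : IsTransitive G) (p : ℝ) (f : ℕ → ℝ) (x y : V) :
    PE p (fun K => f (cl (G := G) K x).card) = PE p (fun K => f (cl (G := G) K y).card) := by
  obtain ⟨φ, rfl⟩ := hG x y
  rw [← PE_map φ p (fun K => f (cl (G := G) K (φ x)).card)]
  congr 1; funext K; congr 1
  have : cl (K.map (edgeMap φ).toEmbedding) (φ x) = (cl K x).map φ.toEquiv.toEmbedding := by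
    ext z
    obtain ⟨w, rfl⟩ := φ.surjective z
    rw [mem_cl, Cn_map_iff, Finset.mem_map]
    constructor
    · intro h; exact ⟨w, mem_cl.2 h, rfl⟩
    · rintro ⟨w', hw', he⟩
      have : w' = w := φ.injective he
      rw [← this]; exact mem_cl.1 hw'
  rw [this, Finset.card_map]

lemma chi_transitive (hG : IsTransitive G) (p : ℝ) (x y : V) : chi G x p = chi G y p := by
  rw [chi_eq, chi_eq]; exact PE_cl_transitive hG p (fun n => (n : ℝ)) x y

end graph
end PercAux


namespace PercAux
open Percolation

section graph
variable {V : Type*} [Fintype V] [DecidableEq V] {G : SimpleGraph V}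

lemma tau_nonneg {p : ℝ} (h0 : 0 ≤ p) (h1 : p ≤ 1) (x y : V) : 0 ≤ tau G p x y := by
  rw [tau_eq]; exact PE_nonneg h0 h1 (fun K => ind_nonneg _)

lemma tau_le_one {p : ℝ} (h0 : 0 ≤ p) (h1 : p ≤ 1) (x y : V) : tau G p x y ≤ 1 := by
  rw [tau_eq]
  have := PE_mono (α := G.edgeSet) h0 h1 (g := fun _ => 1) (fun K => ind_le_one (Cn K x y))
  rwa [PE_const] at this

/-- probability that all labels in `X` are connected to `a` -/
def qq (G : SimpleGraph V) (p : ℝ) (N : ℕ) (a : V) (X : Finset (V × Fin N)) : ℝ :=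
  PE p (fun K => ind (allC (G := G) Prod.fst a X K))

lemma qq_nonneg {p : ℝ} (h0 : 0 ≤ p) (h1 : p ≤ 1) (N : ℕ) (a : V) (X : Finset (V × Fin N)) :
    0 ≤ qq G p N a X := PE_nonneg h0 h1 (fun K => ind_nonneg _)

lemma dj_comm {α : Type*} [DecidableEq α] {A B : Finset α → Prop} {K : Finset α}
    (h : dj A B K) : dj B A K := by
  obtain ⟨K₁, K₂, h1, h2, h3, h4, h5⟩ := h
  exact ⟨K₂, K₁, h2, h1, h3.symm, h5, h4⟩

lemma BK3 {p : ℝ} (h0 : 0 ≤ p) (h1 : p ≤ 1) {ι : Type*} (pos : ι → V) (a u : V)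
    (A B : Finset ι) :
    PE p (fun K => ind (dj (fun K => Cn (G := G) K a u) (dj (allC pos u A) (allC pos u B)) K)) ≤
      tau G p a u * (PE p (fun K => ind (allC (G := G) pos u A K)) *
        PE p (fun K => ind (allC (G := G) pos u B K))) := by
  refine (BK h0 h1 _ _ (Cn_up a u) (dj_up _ _)).trans ?_
  rw [← tau_eq]
  exact mul_le_mul_of_nonneg_left (BK h0 h1 _ _ (allC_up pos u A) (allC_up pos u B))
    (tau_nonneg h0 h1 _ _)

lemma decomp_PE {p : ℝ} (h0 : 0 ≤ p) (h1 : p ≤ 1) {ι : Type*} [DecidableEq ι] (pos : ι → V)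
    (a : V) (X : Finset ι) (hX : 2 ≤ X.card) :
    2 * PE p (fun K => ind (allC (G := G) pos a X K)) ≤
      ∑ A ∈ X.powerset.filter (fun A => A.Nonempty ∧ (X \ A).Nonempty), ∑ u, tau G p a u *
        (PE p (fun K => ind (allC (G := G) pos u A K)) *
          PE p (fun K => ind (allC (G := G) pos u (X \ A) K))) := by
  have key : ∀ K : Finset G.edgeSet, 2 * ind (allC (G := G) pos a X K) ≤
      ∑ A ∈ X.powerset.filter (fun A => A.Nonempty ∧ (X \ A).Nonempty), ∑ u,
        ind (dj (fun K => Cn (G := G) K a u) (dj (allC pos u A) (allC pos u (X \ A))) K) := by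
    intro K
    by_cases h : allC (G := G) pos a X K
    · obtain ⟨u, A, hA, hAn, hAX, hd⟩ := decomp pos X hX K a h
      have hXA : (X \ A).Nonempty := by
        rw [Finset.sdiff_nonempty]
        intro h'; exact hAX (Finset.Subset.antisymm hA h')
      have hXX : X \ (X \ A) = A := by rw [Finset.sdiff_sdiff_eq_self hA]
      have hne : A ≠ X \ A := by
        intro h'
        obtain ⟨i, hi⟩ := hAn
        have h2 := hi
        rw [h', Finset.mem_sdiff] at h2
        exact h2.2 hi
      have hd' : dj (fun K => Cn (G := G) K a u)
          (dj (allC pos u (X \ A)) (allC pos u (X \ (X \ A)))) K := by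
        rw [hXX]
        exact dj_mono (fun _ h => h) (fun _ h => dj_comm h) K hd
      rw [ind_true h]
      have hsub : ({A, X \ A} : Finset (Finset ι)) ⊆
          X.powerset.filter (fun A => A.Nonempty ∧ (X \ A).Nonempty) := by
        intro B hB
        rw [Finset.mem_insert, Finset.mem_singleton] at hB
        rw [Finset.mem_filter, Finset.mem_powerset]
        rcases hB with rfl | rfl
        · exact ⟨hA, hAn, hXA⟩
        · exact ⟨Finset.sdiff_subset, hXA, by rw [hXX]; exact hAn⟩
      refine le_trans ?_ (Finset.sum_le_sum_of_subset_of_nonneg hsub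
        (fun _ _ _ => Finset.sum_nonneg fun _ _ => ind_nonneg _))
      rw [Finset.sum_pair hne]
      have e1 := Finset.single_le_sum (f := fun u => ind (dj (fun K => Cn (G := G) K a u)
        (dj (allC pos u A) (allC pos u (X \ A))) K)) (fun _ _ => ind_nonneg _)
        (Finset.mem_univ u)
      have e2 := Finset.single_le_sum (f := fun u => ind (dj (fun K => Cn (G := G) K a u)
        (dj (allC pos u (X \ A)) (allC pos u (X \ (X \ A)))) K)) (fun _ _ => ind_nonneg _)
        (Finset.mem_univ u)
      simp only [ind_true hd, ind_true hd'] at e1 e2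
      linarith
    · rw [ind_false h, mul_zero]
      exact Finset.sum_nonneg fun _ _ => Finset.sum_nonneg fun _ _ => ind_nonneg _
  have := PE_mono h0 h1 key
  rw [PE_mul_left, PE_sum] at this
  refine this.trans (Finset.sum_le_sum fun A _ => ?_)
  rw [PE_sum]
  exact Finset.sum_le_sum fun u _ => BK3 h0 h1 pos a u A _

/-- nonempty finsets -/
def nes (ι : Type*) [Fintype ι] [DecidableEq ι] : Finset (Finset ι) :=
  Finset.univ.filter (fun A => A.Nonempty)

lemma sum_pairs {ι : Type*} [Fintype ι] [DecidableEq ι] (F : Finset ι → Finset ι → ℝ)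
    (hF : ∀ A B, 0 ≤ F A B) (T : Finset (Finset ι)) :
    ∑ X ∈ T, ∑ A ∈ X.powerset.filter (fun A => A.Nonempty ∧ (X \ A).Nonempty), F A (X \ A) ≤
      ∑ A ∈ nes ι, ∑ B ∈ nes ι, F A B := by
  rw [Finset.sum_sigma', ← Finset.sum_product']
  have hinj : Set.InjOn (fun x : (_ : Finset ι) × Finset ι => (x.2, x.1 \ x.2))
      (T.sigma fun X => X.powerset.filter (fun A => A.Nonempty ∧ (X \ A).Nonempty)) := by
    rintro ⟨X, A⟩ hx ⟨Y, B⟩ hy h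
    simp only [Finset.coe_sigma, Set.mem_sigma_iff, Finset.mem_coe, Finset.mem_filter,
      Finset.mem_powerset] at hx hy
    simp only [Prod.mk.injEq] at h
    obtain ⟨rfl, h2⟩ := h
    have : X = Y := by
      rw [← Finset.sdiff_union_of_subset hx.2.1, h2, Finset.sdiff_union_of_subset hy.2.1]
    subst this; rfl
  rw [← Finset.sum_image (f := fun y : Finset ι × Finset ι => F y.1 y.2) hinj]
  apply Finset.sum_le_sum_of_subset_of_nonneg
  · intro y hy
    rw [Finset.mem_image] at hy
    obtain ⟨⟨X, A⟩, hx, rfl⟩ := hy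
    simp only [Finset.mem_sigma, Finset.mem_filter] at hx
    simp [nes, hx.2.2]
  · intro y _ _; exact hF _ _

lemma qq_sum {p : ℝ} (h0 : 0 ≤ p) (h1 : p ≤ 1) (N : ℕ) (a : V) (c : ℕ → ℝ) (hc : ∀ n, 0 ≤ c n) :
    ∑ X ∈ nes (V × Fin N), c X.card * qq G p N a X ≤ c 1 * (N * chi G a p) +
      (1 / 2) * ∑ u, tau G p a u * ∑ A ∈ nes (V × Fin N), ∑ B ∈ nes (V × Fin N),
        c (A.card + B.card) * (qq G p N u A * qq G p N u B) := by
  have hsplit : nes (V × Fin N) = (nes (V × Fin N)).filter (fun X => X.card = 1) ∪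
      (nes (V × Fin N)).filter (fun X => ¬ X.card = 1) := by
    rw [Finset.filter_union_filter_not_eq]
  rw [← Finset.sum_filter_add_sum_filter_not _ (fun X => X.card = 1)]
  apply add_le_add
  · have : (nes (V × Fin N)).filter (fun X => X.card = 1) =
        Finset.univ.image (fun i : V × Fin N => ({i} : Finset (V × Fin N))) := by
      ext X
      simp only [nes, Finset.mem_filter, Finset.mem_univ, true_and, Finset.mem_image,
        Finset.card_eq_one]
      constructor
      · rintro ⟨_, i, rfl⟩; exact ⟨i, rfl⟩
      · rintro ⟨i, rfl⟩; exact ⟨by simp, i, rfl⟩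
    rw [this, Finset.sum_image (by intro i _ j _ h; simpa using h)]
    simp only [Finset.card_singleton]
    rw [← Finset.mul_sum]
    apply le_of_eq
    congr 1
    have : ∀ i : V × Fin N, qq G p N a {i} = tau G p a i.1 := by
      intro i
      rw [qq, tau_eq]
      congr 1; funext K; apply ind_congr; simp [allC]
    simp only [this]
    rw [Fintype.sum_prod_type, chi_eq_sum]
    simp [Finset.mul_sum]
  · have h2 : ∀ X ∈ (nes (V × Fin N)).filter (fun X => ¬ X.card = 1),
        c X.card * qq G p N a X ≤ (1 / 2) *
          ∑ A ∈ X.powerset.filter (fun A => A.Nonempty ∧ (X \ A).Nonempty),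
            (∑ u, tau G p a u * (c (A.card + (X \ A).card) *
              (qq G p N u A * qq G p N u (X \ A)))) := by
      intro X hX
      simp only [nes, Finset.mem_filter, Finset.mem_univ, true_and] at hX
      have hX2 : 2 ≤ X.card := by
        have := Finset.card_pos.2 hX.1
        omega
      have := decomp_PE (G := G) h0 h1 Prod.fst a X hX2
      have h3 := mul_le_mul_of_nonneg_left this (hc X.card)
      have h4 : c X.card * qq G p N a X = (1 / 2) * (c X.card * (2 * qq G p N a X)) := by ring
      rw [h4]
      apply mul_le_mul_of_nonneg_left _ (by norm_num)
      refine h3.trans (le_of_eq ?_)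
      rw [Finset.mul_sum]
      apply Finset.sum_congr rfl
      intro A hA
      rw [Finset.mem_filter, Finset.mem_powerset] at hA
      have : A.card + (X \ A).card = X.card := by
        rw [add_comm]; exact Finset.card_sdiff_add_card_eq_card hA.1
      rw [this, Finset.mul_sum]
      apply Finset.sum_congr rfl
      intro u _
      unfold qq
      ring
    refine (Finset.sum_le_sum h2).trans ?_
    rw [← Finset.mul_sum]
    apply mul_le_mul_of_nonneg_left _ (by norm_num)
    refine (sum_pairs (fun A B => ∑ u, tau G p a u * (c (A.card + B.card) *
      (qq G p N u A * qq G p N u B))) ?_ _).trans (le_of_eq ?_)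
    · intro A B
      exact Finset.sum_nonneg fun u _ => mul_nonneg (tau_nonneg h0 h1 _ _)
        (mul_nonneg (hc _) (mul_nonneg (qq_nonneg h0 h1 _ _ _) (qq_nonneg h0 h1 _ _ _)))
    · simp only [Finset.mul_sum]
      rw [Finset.sum_comm]
      rw [Finset.sum_comm (s := Finset.univ) (t := nes (V × Fin N))]
      rw [Finset.sum_comm]
      apply Finset.sum_congr rfl
      intro A _
      rw [Finset.sum_comm]

lemma sum_card_pow {ι : Type*} [DecidableEq ι] (S : Finset ι) (s : ℝ) :
    ∑ X ∈ S.powerset, (X.card : ℝ) * s ^ (X.card - 1) = S.card * (1 + s) ^ (S.card - 1) := by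
  induction S using Finset.induction_on with
  | empty => simp
  | insert e S he ih =>
    rw [Finset.sum_powerset_insert he, ih]
    have h1 : ∀ X ∈ S.powerset, ((insert e X).card : ℝ) * s ^ ((insert e X).card - 1) =
        s * ((X.card : ℝ) * s ^ (X.card - 1)) + s ^ X.card := by
      intro X hX
      have : e ∉ X := fun h => he (Finset.mem_powerset.1 hX h)
      rw [Finset.card_insert_of_notMem this]
      rcases Nat.eq_zero_or_pos X.card with h | h
      · simp [h]
      · obtain ⟨m, hm⟩ := Nat.exists_eq_succ_of_ne_zero h.ne'
        rw [hm]; simp [pow_succ]; ring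
    rw [Finset.sum_congr rfl h1, Finset.sum_add_distrib, ← Finset.mul_sum, ih]
    have h2 : ∑ X ∈ S.powerset, s ^ X.card = (1 + s) ^ S.card := by
      have := Finset.sum_pow_mul_eq_add_pow s 1 S
      simp only [one_pow, mul_one] at this
      rw [this, add_comm]
    rw [h2, Finset.card_insert_of_notMem he]
    rcases Nat.eq_zero_or_pos S.card with h | h
    · simp [h]
    · obtain ⟨m, hm⟩ := Nat.exists_eq_succ_of_ne_zero h.ne'
      rw [hm]; simp [pow_succ]; ring

lemma qq_gen (p : ℝ) (N : ℕ) (a : V) (c : ℕ → ℝ) :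
    ∑ X, c X.card * qq G p N a X = PE p (fun K =>
      ∑ X ∈ ((cl (G := G) K a) ×ˢ (Finset.univ : Finset (Fin N))).powerset, c X.card) := by
  have : ∀ K : Finset G.edgeSet,
      ∑ X ∈ ((cl (G := G) K a) ×ˢ (Finset.univ : Finset (Fin N))).powerset, c X.card =
      ∑ X : Finset (V × Fin N), c X.card * ind (allC (G := G) Prod.fst a X K) := by
    intro K
    have h : ((cl (G := G) K a) ×ˢ (Finset.univ : Finset (Fin N))).powerset =
        Finset.univ.filter (fun X => allC (G := G) Prod.fst a X K) := by
      ext X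
      rw [Finset.mem_filter]
      simp only [Finset.mem_powerset, Finset.mem_univ, true_and, allC,
        Finset.subset_iff, Finset.mem_product, mem_cl, and_true]
    rw [h, Finset.sum_filter]
    apply Finset.sum_congr rfl
    intro X _
    unfold ind
    split_ifs <;> simp
  simp only [this]
  rw [PE_sum]
  apply Finset.sum_congr rfl
  intro X _
  rw [PE_mul_left]; rfl

lemma sum_nes {ι : Type*} [Fintype ι] [DecidableEq ι] (f : Finset ι → ℝ) :
    ∑ X, f X = f ∅ + ∑ X ∈ nes ι, f X := by
  have : nes ι = Finset.univ.erase ∅ := by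
    ext X; simp [nes, Finset.nonempty_iff_ne_empty]
  rw [this, Finset.add_sum_erase _ _ (Finset.mem_univ _)]

/-- generating function -/
def HH (G : SimpleGraph V) (p : ℝ) (N : ℕ) (a : V) (s : ℝ) : ℝ :=
  PE p (fun K => (1 + s) ^ (N * (cl (G := G) K a).card)) - 1

/-- derivative of the generating function -/
def GG (G : SimpleGraph V) (p : ℝ) (N : ℕ) (a : V) (s : ℝ) : ℝ :=
  PE p (fun K => ((N * (cl (G := G) K a).card : ℕ) : ℝ) *
    (1 + s) ^ (N * (cl (G := G) K a).card - 1))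

lemma HH_eq (p : ℝ) (N : ℕ) (a : V) (s : ℝ) :
    ∑ X ∈ nes (V × Fin N), s ^ X.card * qq G p N a X = HH G p N a s := by
  have h1 := qq_gen (G := G) p N a (fun n => s ^ n)
  rw [sum_nes] at h1
  have h2 : qq G p N a ∅ = 1 := by
    rw [qq]
    have : ∀ K, ind (allC (G := G) (Prod.fst : V × Fin N → V) a ∅ K) = 1 :=
      fun K => ind_true (by simp [allC])
    simp only [this, PE_const]
  have h3 : ∀ S : Finset (V × Fin N), ∑ X ∈ S.powerset, s ^ X.card = (1 + s) ^ S.card := by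
    intro S
    have := Finset.sum_pow_mul_eq_add_pow s 1 S
    simp only [one_pow, mul_one] at this
    rw [this, add_comm]
  simp only [h3, Finset.card_empty, pow_zero, h2, Finset.card_product, Finset.card_univ,
    Fintype.card_fin] at h1
  unfold HH
  simp only [mul_comm N]
  linarith

lemma GG_eq (p : ℝ) (N : ℕ) (a : V) (s : ℝ) :
    ∑ X ∈ nes (V × Fin N), ((X.card : ℝ) * s ^ (X.card - 1)) * qq G p N a X = GG G p N a s := by
  have h1 := qq_gen (G := G) p N a (fun n => (n : ℝ) * s ^ (n - 1))
  rw [sum_nes] at h1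
  simp only [sum_card_pow, Finset.card_empty, Nat.cast_zero, zero_mul, zero_add,
    Finset.card_product, Finset.card_univ, Fintype.card_fin] at h1
  unfold GG
  simp only [mul_comm N]
  exact h1

lemma HH_ineq (hG : IsTransitive G) {p : ℝ} (h0 : 0 ≤ p) (h1 : p ≤ 1) (N : ℕ) (a : V) {s : ℝ}
    (hs : 0 ≤ s) : HH G p N a s ≤ s * (N * chi G a p) + (1 / 2) * (chi G a p * HH G p N a s ^ 2) := by
  have := qq_sum (G := G) h0 h1 N a (fun n => s ^ n) (fun n => by positivity)
  simp only [HH_eq, pow_one] at this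
  refine this.trans (le_of_eq ?_)
  congr 2
  rw [chi_eq_sum, Finset.sum_mul]
  apply Finset.sum_congr rfl
  intro u _
  congr 1
  have hu : HH G p N a s = HH G p N u s := by
    unfold HH
    rw [PE_cl_transitive hG p (fun n => (1 + s) ^ (N * n)) a u]
  rw [hu, ← HH_eq, sq, Finset.sum_mul_sum]
  apply Finset.sum_congr rfl; intro A _
  apply Finset.sum_congr rfl; intro B _
  rw [pow_add]; ring

lemma GG_ineq (hG : IsTransitive G) {p : ℝ} (h0 : 0 ≤ p) (h1 : p ≤ 1) (N : ℕ) (a : V) {s : ℝ}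
    (hs : 0 ≤ s) : GG G p N a s ≤ N * chi G a p + chi G a p * (GG G p N a s * HH G p N a s) := by
  have := qq_sum (G := G) h0 h1 N a (fun n => (n : ℝ) * s ^ (n - 1)) (fun n => by positivity)
  simp only [GG_eq] at this
  refine this.trans (le_of_eq ?_)
  simp only [Nat.cast_one, Nat.sub_self, pow_zero, mul_one, one_mul]
  congr 1
  rw [chi_eq_sum, Finset.sum_mul, Finset.mul_sum]
  apply Finset.sum_congr rfl
  intro u _
  have hu : HH G p N a s = HH G p N u s := by
    unfold HH
    rw [PE_cl_transitive hG p (fun n => (1 + s) ^ (N * n)) a u]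
  have hu' : GG G p N a s = GG G p N u s := by
    unfold GG
    rw [PE_cl_transitive hG p (fun n => ((N * n : ℕ) : ℝ) * (1 + s) ^ (N * n - 1)) a u]
  have : ∑ A ∈ nes (V × Fin N), ∑ B ∈ nes (V × Fin N),
      ((A.card + B.card : ℕ) : ℝ) * s ^ (A.card + B.card - 1) * (qq G p N u A * qq G p N u B) =
      2 * (GG G p N u s * HH G p N u s) := by
    have e : 2 * (GG G p N u s * HH G p N u s) =
        GG G p N u s * HH G p N u s + HH G p N u s * GG G p N u s := by ring
    rw [e, ← GG_eq, ← HH_eq, Finset.sum_mul_sum, Finset.sum_mul_sum, ← Finset.sum_add_distrib]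
    apply Finset.sum_congr rfl; intro A hA
    rw [← Finset.sum_add_distrib]
    apply Finset.sum_congr rfl; intro B hB
    simp only [nes, Finset.mem_filter, Finset.mem_univ, true_and] at hA hB
    obtain ⟨m, hm⟩ := Nat.exists_eq_succ_of_ne_zero (Finset.card_pos.2 hA).ne'
    obtain ⟨n, hn⟩ := Nat.exists_eq_succ_of_ne_zero (Finset.card_pos.2 hB).ne'
    rw [hm, hn]
    have : m.succ + n.succ - 1 = m + n + 1 := by omega
    rw [this]
    simp only [Nat.succ_eq_add_one, Nat.add_sub_cancel]
    push_cast
    rw [pow_succ, pow_add, pow_succ, pow_succ]; ring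
  rw [this, hu, hu']; ring

lemma one_le_chi {p : ℝ} (h0 : 0 ≤ p) (h1 : p ≤ 1) (a : V) : 1 ≤ chi G a p := by
  rw [chi_eq]
  have := PE_mono (α := G.edgeSet) h0 h1 (f := fun _ => 1)
    (g := fun K => ((cl (G := G) K a).card : ℝ)) (fun K => by exact_mod_cast cl_pos K a)
  rwa [PE_const] at this

lemma HH_lt (hG : IsTransitive G) {p : ℝ} (h0 : 0 ≤ p) (h1 : p ≤ 1) (N : ℕ) (a : V) {s : ℝ}
    (hs : 0 ≤ s) (hs1 : 2 * N * s * chi G a p ^ 2 < 1) :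
    chi G a p * HH G p N a s < 1 ∧
      1 - 2 * N * s * chi G a p ^ 2 ≤ (1 - chi G a p * HH G p N a s) ^ 2 := by
  have hχ := one_le_chi (G := G) h0 h1 a
  have hsq : ∀ s', 0 ≤ s' →
      1 - 2 * N * s' * chi G a p ^ 2 ≤ (1 - chi G a p * HH G p N a s') ^ 2 := by
    intro s' hs'
    have := HH_ineq hG h0 h1 N a hs'
    nlinarith [mul_le_mul_of_nonneg_left this (by linarith : 0 ≤ chi G a p)]
  refine ⟨?_, hsq s hs⟩
  by_contra hcon
  push Not at hcon
  have hcont : Continuous (fun s' => chi G a p * HH G p N a s') := by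
    unfold HH
    simp only [PE_eq]
    fun_prop
  have hz : chi G a p * HH G p N a 0 = 0 := by
    unfold HH; simp [PE_const]
  have := intermediate_value_Icc hs hcont.continuousOn
  obtain ⟨s', hs', he⟩ := this (show (1 : ℝ) ∈ _ by
    simp only [hz]; exact ⟨zero_le_one, hcon⟩)
  have h2 := hsq s' hs'.1
  simp only at he
  rw [he] at h2
  have : 2 * N * s' * chi G a p ^ 2 ≤ 2 * N * s * chi G a p ^ 2 := by
    have := hs'.2
    gcongr
  norm_num at h2
  linarith

lemma GG_bound (hG : IsTransitive G) {p : ℝ} (h0 : 0 ≤ p) (h1 : p ≤ 1) (N : ℕ) (a : V) {s : ℝ}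
    (hs : 0 ≤ s) (hs1 : 2 * N * s * chi G a p ^ 2 < 1) :
    GG G p N a s ≤ N * chi G a p / Real.sqrt (1 - 2 * N * s * chi G a p ^ 2) := by
  obtain ⟨h2, h3⟩ := HH_lt hG h0 h1 N a hs hs1
  have h4 := GG_ineq hG h0 h1 N a hs
  have hpos : 0 < Real.sqrt (1 - 2 * N * s * chi G a p ^ 2) := Real.sqrt_pos.2 (by linarith)
  have h5 : Real.sqrt (1 - 2 * N * s * chi G a p ^ 2) ≤ 1 - chi G a p * HH G p N a s :=
    Real.sqrt_le_iff.2 ⟨by linarith, h3⟩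
  rw [le_div_iff₀ hpos]
  have h6 : 0 ≤ GG G p N a s := by
    unfold GG
    exact PE_nonneg h0 h1 (fun K => by positivity)
  calc _ ≤ GG G p N a s * (1 - chi G a p * HH G p N a s) := mul_le_mul_of_nonneg_left h5 h6
    _ ≤ _ := by linarith

/-- the exponential bound -/
theorem exp_bound (hG : IsTransitive G) {p : ℝ} (h0 : 0 ≤ p) (h1 : p ≤ 1) (a : V) {t : ℝ}
    (ht : 0 ≤ t) (ht1 : 2 * t * chi G a p ^ 2 < 1) :
    PE p (fun K => ((cl (G := G) K a).card : ℝ) * Real.exp (t * (cl (G := G) K a).card)) ≤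
      chi G a p / Real.sqrt (1 - 2 * t * chi G a p ^ 2) := by
  have hb : ∀ N : ℕ, 1 ≤ N → PE p (fun K => ((cl (G := G) K a).card : ℝ) *
      (((1 + t / N) ^ N) ^ (cl (G := G) K a).card / (1 + t / N))) ≤
      chi G a p / Real.sqrt (1 - 2 * t * chi G a p ^ 2) := by
    intro N hN
    have hN' : (0 : ℝ) < N := by exact_mod_cast hN
    have e1 : 2 * N * (t / N) * chi G a p ^ 2 = 2 * t * chi G a p ^ 2 := by
      field_simp
    have := GG_bound hG h0 h1 N a (s := t / N) (by positivity) (by rw [e1]; exact ht1)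
    rw [e1] at this
    have e2 : GG G p N a (t / N) = N * PE p (fun K => ((cl (G := G) K a).card : ℝ) *
      (((1 + t / N) ^ N) ^ (cl (G := G) K a).card / (1 + t / N))) := by
      rw [← PE_mul_left]
      unfold GG
      congr 1; funext K
      have hc := cl_pos K a
      obtain ⟨m, hm⟩ : ∃ m, N * (cl K a).card = m + 1 :=
        Nat.exists_eq_succ_of_ne_zero (by positivity)
      have hpos : (1 + t / N) ≠ 0 := by positivity
      rw [← pow_mul]
      rw [← mul_assoc]
      push_cast
      congr 1
      rw [hm, pow_succ, Nat.add_sub_cancel]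
      field_simp
    rw [e2, mul_div_assoc] at this
    exact le_of_mul_le_mul_left this hN'
  refine le_of_tendsto' (x := Filter.atTop)
    (f := fun N : ℕ => PE p (fun K => ((cl (G := G) K a).card : ℝ) *
      (((1 + t / ((N + 1 : ℕ) : ℝ)) ^ (N + 1)) ^ (cl (G := G) K a).card /
        (1 + t / ((N + 1 : ℕ) : ℝ))))) ?_ (fun N => hb (N + 1) (by omega))
  simp only [PE_eq]
  apply tendsto_finsetSum
  intro K _
  apply Filter.Tendsto.const_mul
  apply Filter.Tendsto.const_mul
  have l1 := (Real.tendsto_one_add_div_pow_exp t).comp (Filter.tendsto_add_atTop_nat 1)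
  have l2 : Filter.Tendsto (fun N : ℕ => 1 + t / ((N + 1 : ℕ) : ℝ)) Filter.atTop (nhds (1 + 0)) := by
    apply Filter.Tendsto.const_add
    exact (tendsto_const_div_atTop_nhds_zero_nat t).comp (Filter.tendsto_add_atTop_nat 1)
  have l3 := (l1.pow (cl K a).card).div l2 (by norm_num)
  rw [add_zero, div_one, ← Real.exp_nat_mul, mul_comm] at l3
  exact l3

end graph
end PercAux


namespace PercAux
open Percolation

section graph
variable {V : Type*} [Fintype V] [DecidableEq V] {G : SimpleGraph V}

lemma PE_sq_le {α : Type*} [DecidableEq α] [Fintype α] {p : ℝ} (h0 : 0 ≤ p) (h1 : p ≤ 1)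
    (f g : Finset α → ℝ) :
    PE p (fun K => f K * g K) ^ 2 ≤ PE p (fun K => f K ^ 2) * PE p (fun K => g K ^ 2) := by
  simp only [PE_eq]
  apply Finset.sum_sq_le_sum_mul_sum_of_sq_le_mul
  · intro K _; exact mul_nonneg (wtS_nonneg h0 h1 _ _) (sq_nonneg _)
  · intro K _; exact mul_nonneg (wtS_nonneg h0 h1 _ _) (sq_nonneg _)
  · intro K _; apply le_of_eq; ring

lemma sum_edge_ind (u v : V) (c : ℝ) :
    ∑ e : G.edgeSet, ind (e.1 = s(u, v)) * c = ind (G.Adj u v) * c := by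
  by_cases h : G.Adj u v
  · rw [ind_true h, Finset.sum_eq_single (⟨s(u, v), h⟩ : G.edgeSet)]
    · rw [ind_true rfl]
    · intro e _ he
      rw [ind_false (fun h' => he (Subtype.ext h')), zero_mul]
    · intro h'; exact absurd (Finset.mem_univ _) h'
  · rw [ind_false h, zero_mul]
    apply Finset.sum_eq_zero
    intro e _
    rw [ind_false, zero_mul]
    intro h'
    have := e.2
    rw [h'] at this
    exact h this

lemma sum_dart (x y : V) (hxy : x ≠ y) (a : V → V → ℝ) :
    ∑ u, ∑ v, ind (s(x, y) = s(u, v)) * a u v = a x y + a y x := by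
  have : ∀ u v, ind (s(x, y) = s(u, v)) * a u v =
      (if u = x then (if v = y then a x y else 0) else 0) +
      (if u = y then (if v = x then a y x else 0) else 0) := by
    intro u v
    unfold ind
    simp only [Sym2.eq_iff]
    by_cases h1 : u = x <;> by_cases h2 : v = y <;> by_cases h3 : u = y <;> by_cases h4 : v = x <;>
      simp_all [eq_comm]
  simp only [this, Finset.sum_add_distrib]
  simp

/-- dart sums as edge sums -/
lemma dart_edge (a : V → V → ℝ) :
    ∑ u, ∑ v, ind (G.Adj u v) * a u v =
      ∑ e : G.edgeSet, ∑ u, ∑ v, ind (e.1 = s(u, v)) * a u v := by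
  rw [Finset.sum_comm]
  simp only [← sum_edge_ind (G := G)]
  rw [Finset.sum_comm]
  rw [Finset.sum_comm (s := (Finset.univ : Finset G.edgeSet))]
  apply Finset.sum_congr rfl; intro u _
  rw [Finset.sum_comm]

lemma sum_touch_le {Ω : ℕ} (hΩ : ∀ u, ∑ v, ind (G.Adj u v) = (Ω : ℝ)) (K : Finset G.edgeSet)
    (a : V) : ∑ e, ind (touch K a e) ≤ Ω * (cl K a).card := by
  have h1 : ∀ e : G.edgeSet, ind (touch K a e) ≤
      ∑ u, ∑ v, ind (e.1 = s(u, v)) * ind (Cn K a u) := by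
    rintro ⟨e, he⟩
    induction e using Sym2.ind with
    | _ x y =>
      have hne : x ≠ y := G.ne_of_adj he
      simp only
      rw [sum_dart x y hne (fun u v => ind (Cn K a u))]
      by_cases ht : touch K a ⟨s(x, y), he⟩
      · obtain ⟨w, hw, hc⟩ := ht
        rw [Sym2.mem_iff] at hw
        rw [ind_true ⟨w, by simpa using hw, hc⟩]
        rcases hw with rfl | rfl
        · rw [ind_true hc]; linarith [ind_nonneg (Cn K a y)]
        · rw [ind_true hc]; linarith [ind_nonneg (Cn K a x)]
      · rw [ind_false ht]
        exact add_nonneg (ind_nonneg _) (ind_nonneg _)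
  refine (Finset.sum_le_sum fun e _ => h1 e).trans (le_of_eq ?_)
  rw [← dart_edge (fun u v => ind (Cn K a u)), cl_card, Finset.mul_sum]
  apply Finset.sum_congr rfl; intro u _
  rw [← Finset.sum_mul, hΩ]

/-- centered edge variable -/
def Ye (p : ℝ) (K : Finset G.edgeSet) (e : G.edgeSet) : ℝ := ind (e ∈ K) - p

lemma Ye_insert (p : ℝ) (K : Finset G.edgeSet) (e : G.edgeSet) : Ye p (insert e K) e = 1 - p := by
  rw [Ye, ind_true (Finset.mem_insert_self _ _)]
lemma Ye_erase (p : ℝ) (K : Finset G.edgeSet) (e : G.edgeSet) : Ye p (K.erase e) e = - p := by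
  rw [Ye, ind_false (Finset.notMem_erase _ _)]; ring
lemma Ye_insert_ne (p : ℝ) (K : Finset G.edgeSet) {e f : G.edgeSet} (h : f ≠ e) :
    Ye p (insert e K) f = Ye p K f := by
  unfold Ye; congr 1; apply ind_congr; simp [h]
lemma Ye_erase_ne (p : ℝ) (K : Finset G.edgeSet) {e f : G.edgeSet} (h : f ≠ e) :
    Ye p (K.erase e) f = Ye p K f := by
  unfold Ye; congr 1; apply ind_congr; simp [h]

lemma tI (K : Finset G.edgeSet) (a : V) (e : G.edgeSet) :
    ind (touch (insert e K) a e) = ind (touch K a e) := ind_congr touch_insert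
lemma tE (K : Finset G.edgeSet) (a : V) (e : G.edgeSet) :
    ind (touch (K.erase e) a e) = ind (touch K a e) := ind_congr touch_erase

lemma diag (p : ℝ) (a : V) (e : G.edgeSet) :
    PE p (fun K => ind (touch K a e) * Ye p K e * (ind (touch K a e) * Ye p K e)) =
      p * (1 - p) * PE p (fun K => ind (touch K a e)) := by
  rw [PE_resample p e, ← PE_mul_left]
  congr 1; funext K
  rw [tI, tE, Ye_insert, Ye_erase]
  by_cases h : touch K a e
  · rw [ind_true h]; ring
  · rw [ind_false h]; ring

lemma offdiag (p : ℝ) (a : V) {e f : G.edgeSet} (hef : e ≠ f) :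
    PE p (fun K => ind (touch K a e) * Ye p K e * (ind (touch K a f) * Ye p K f)) = 0 := by
  rw [PE_resample p e]
  have h1 : ∀ K : Finset G.edgeSet,
      p * (ind (touch (insert e K) a e) * Ye p (insert e K) e *
        (ind (touch (insert e K) a f) * Ye p (insert e K) f)) +
      (1 - p) * (ind (touch (K.erase e) a e) * Ye p (K.erase e) e *
        (ind (touch (K.erase e) a f) * Ye p (K.erase e) f)) =
      p * (1 - p) * (ind (touch K a e) * Ye p K f *
        (ind (touch (insert e K) a f) - ind (touch (K.erase e) a f))) := by
    intro K
    rw [tI, tE, Ye_insert, Ye_erase, Ye_insert_ne _ _ hef.symm, Ye_erase_ne _ _ hef.symm]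
    ring
  simp only [h1]
  rw [PE_mul_left]
  apply mul_eq_zero_of_right
  rw [PE_resample p f]
  rw [← PE_const (α := G.edgeSet) p 0]
  congr 1; funext K
  have c1 : insert e (K.erase f) = (insert e K).erase f := by
    ext x; simp only [Finset.mem_insert, Finset.mem_erase]
    constructor
    · rintro (rfl | h)
      · exact ⟨hef, Or.inl rfl⟩
      · exact ⟨h.1, Or.inr h.2⟩
    · rintro ⟨h, rfl | h'⟩
      · exact Or.inl rfl
      · exact Or.inr ⟨h, h'⟩
  have c2 : (insert f K).erase e = insert f (K.erase e) := by
    ext x; simp only [Finset.mem_insert, Finset.mem_erase]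
    constructor
    · rintro ⟨h, rfl | h'⟩
      · exact Or.inl rfl
      · exact Or.inr ⟨h, h'⟩
    · rintro (rfl | h)
      · exact ⟨hef.symm, Or.inl rfl⟩
      · exact ⟨h.1, Or.inr h.2⟩
  have c3 : (K.erase f).erase e = (K.erase e).erase f := Finset.erase_right_comm
  have c4 : insert e (insert f K) = insert f (insert e K) := Finset.insert_comm _ _ _
  rw [c1, c2, c3, c4, tI, tI, tE, tE, Ye_insert, Ye_erase]
  have hz : (ind (touch (insert f K) a e) - ind (touch (K.erase f) a e)) *
      (ind (touch (insert e K) a f) - ind (touch (K.erase e) a f)) = 0 := by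
    by_cases e1 : touch (K.erase f) a e
    · rw [ind_true e1, ind_true (e1.mono ((Finset.erase_subset _ _).trans
        (Finset.subset_insert _ _)))]; ring
    by_cases e2 : touch (K.erase e) a f
    · rw [ind_true e2, ind_true (e2.mono ((Finset.erase_subset _ _).trans
        (Finset.subset_insert _ _)))]; ring
    have l1 : ¬ touch ((K.erase e).erase f) a f := fun h => e2 (h.mono (Finset.erase_subset _ _))
    have l2 : ¬ touch ((K.erase e).erase f) a e := fun h => e1 (h.mono (by
      rw [← c3]; exact Finset.erase_subset _ _))
    have l3 : ¬ touch (insert f ((K.erase e).erase f)) a e := fun h =>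
      l2 ((touch_of_Cn_iff (Cn_insert_of_not_touch l1) e).1 h)
    have l4 : ¬ touch (insert e (insert f ((K.erase e).erase f))) a e := fun h =>
      l3 (touch_insert.1 h)
    have l5 : ¬ touch (insert f K) a e := fun h => l4 (h.mono (by
      intro x hx
      simp only [Finset.mem_insert, Finset.mem_erase] at hx ⊢
      tauto))
    rw [ind_false l5, ind_false e1]; ring
  linear_combination p * (1 - p) * hz

lemma ET2 {p : ℝ} (h0 : 0 ≤ p) (h1 : p ≤ 1) {Ω : ℕ}
    (hΩ : ∀ u, ∑ v, ind (G.Adj u v) = (Ω : ℝ)) (a : V) :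
    PE p (fun K => (∑ e : G.edgeSet, ind (touch K a e) * Ye p K e) ^ 2) ≤
      p * (1 - p) * (Ω * chi G a p) := by
  have : ∀ K : Finset G.edgeSet, (∑ e : G.edgeSet, ind (touch K a e) * Ye p K e) ^ 2 =
      ∑ e : G.edgeSet, ∑ f : G.edgeSet,
        ind (touch K a e) * Ye p K e * (ind (touch K a f) * Ye p K f) := by
    intro K; rw [sq, Finset.sum_mul_sum]
  simp only [this, PE_sum]
  have h2 : ∀ e : G.edgeSet, ∑ f : G.edgeSet,
      PE p (fun K => ind (touch K a e) * Ye p K e * (ind (touch K a f) * Ye p K f)) =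
      p * (1 - p) * PE p (fun K => ind (touch K a e)) := by
    intro e
    rw [Finset.sum_eq_single e]
    · exact diag p a e
    · intro f _ hf; exact offdiag p a hf.symm
    · intro h; exact absurd (Finset.mem_univ _) h
  simp only [h2]
  rw [← Finset.mul_sum, ← PE_sum]
  apply mul_le_mul_of_nonneg_left _ (mul_nonneg h0 (by linarith))
  rw [chi_eq, ← PE_mul_left]
  exact PE_mono h0 h1 (fun K => sum_touch_le hΩ K a)

/-- boundary functional -/
def bd (K : Finset G.edgeSet) (a u v : V) : ℝ :=
  ind (Cn K a u ∧ ¬ Cn K a v) * (cl K v).card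

lemma bd_nonneg (K : Finset G.edgeSet) (a u v : V) : 0 ≤ bd K a u v :=
  mul_nonneg (ind_nonneg _) (by positivity)

lemma bd_le {K : Finset G.edgeSet} {a u v : V} (h : G.Adj u v) (hu : Cn (K.erase ⟨s(u, v), h⟩) a u)
    (hv : ¬ Cn (K.erase ⟨s(u, v), h⟩) a v) :
    ((cl (K.erase ⟨s(u, v), h⟩) v).card : ℝ) ≤
      (cl (insert ⟨s(u, v), h⟩ K) a).card - (cl (K.erase ⟨s(u, v), h⟩) a).card := by
  set e : G.edgeSet := ⟨s(u, v), h⟩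
  have hsub : K.erase e ⊆ insert e K := (Finset.erase_subset _ _).trans (Finset.subset_insert _ _)
  have hd : Disjoint (cl (K.erase e) v) (cl (K.erase e) a) := by
    rw [Finset.disjoint_left]
    intro x hx hx'
    exact hv ((mem_cl.1 hx').trans (mem_cl.1 hx).symm)
  have hs : cl (K.erase e) v ∪ cl (K.erase e) a ⊆ cl (insert e K) a := by
    apply Finset.union_subset
    · intro x hx
      exact mem_cl.2 ((hu.mono hsub).trans ((Cn_edge h (Finset.mem_insert_self _ _)).trans
        ((mem_cl.1 hx).mono hsub)))
    · exact cl_mono hsub a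
  have := Finset.card_le_card hs
  rw [Finset.card_union_of_disjoint hd] at this
  have : (((cl (K.erase e) v).card + (cl (K.erase e) a).card : ℕ) : ℝ) ≤
    ((cl (insert e K) a).card : ℝ) := by exact_mod_cast this
  push_cast at this
  linarith

lemma edge_bd {p : ℝ} (h0 : 0 ≤ p) (h1 : p ≤ 1) (a : V) (e : G.edgeSet) :
    p * PE p (fun K => ∑ u, ∑ v, ind (e.1 = s(u, v)) * bd (G := G) K a u v) ≤
      PE p (fun K => ((cl (G := G) K a).card : ℝ) * (ind (touch K a e) * Ye p K e)) := by
  rw [PE_resample p e, PE_resample p e (fun K => ((cl (G := G) K a).card : ℝ) *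
    (ind (touch K a e) * Ye p K e)), ← PE_mul_left]
  apply PE_mono h0 h1
  intro K
  rw [tI, tE, Ye_insert, Ye_erase]
  obtain ⟨e, he⟩ := e
  induction e using Sym2.ind with
  | _ x y =>
    have hne : x ≠ y := G.ne_of_adj he
    simp only
    rw [sum_dart x y hne, sum_dart x y hne]
    set e : G.edgeSet := ⟨s(x, y), he⟩ with hedef
    have hc : Cn (insert e K) x y := Cn_edge he (Finset.mem_insert_self _ _)
    have b1 : bd (insert e K) a x y = 0 := by
      rw [bd, ind_false, zero_mul]; rintro ⟨h1, h2⟩; exact h2 (h1.trans hc)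
    have b2 : bd (insert e K) a y x = 0 := by
      rw [bd, ind_false, zero_mul]; rintro ⟨h1, h2⟩; exact h2 (h1.trans hc.symm)
    rw [b1, b2]
    have key : bd (K.erase e) a x y + bd (K.erase e) a y x ≤
        ind (touch K a e) * (((cl (insert e K) a).card : ℝ) - (cl (K.erase e) a).card) := by
      have hmono : ((cl (K.erase e) a).card : ℝ) ≤ (cl (insert e K) a).card := by
        exact_mod_cast Finset.card_le_card (cl_mono ((Finset.erase_subset _ _).trans
          (Finset.subset_insert _ _)) a)
      have hnn : 0 ≤ ind (touch K a e) *
          (((cl (insert e K) a).card : ℝ) - (cl (K.erase e) a).card) :=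
        mul_nonneg (ind_nonneg _) (by linarith)
      by_cases hx : Cn (K.erase e) a x <;> by_cases hy : Cn (K.erase e) a y
      · simpa [bd, hx, hy, ind] using hnn
      · have ht : touch K a e := touch_erase.1 ⟨x, by simp [hedef], hx⟩
        rw [ind_true ht, one_mul]
        have := bd_le he hx hy
        simp only [bd, hx, hy, ind]
        simpa using this
      · have ht : touch K a e := touch_erase.1 ⟨y, by simp [hedef], hy⟩
        rw [ind_true ht, one_mul]
        have hee : e = ⟨s(y, x), he.symm⟩ := Subtype.ext Sym2.eq_swap
        rw [hee] at hx hy ⊢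
        have := bd_le (K := K) he.symm hy hx
        simp only [bd, hx, hy, ind]
        simpa using this
      · simpa [bd, hx, hy, ind] using hnn
    have := mul_le_mul_of_nonneg_left key (mul_nonneg h0 (by linarith : 0 ≤ 1 - p))
    linarith

lemma S_le {p : ℝ} (h0 : 0 ≤ p) (h1 : p ≤ 1) {Ω : ℕ}
    (hΩ : ∀ u, ∑ v, ind (G.Adj u v) = (Ω : ℝ)) (a : V) :
    p * PE p (fun K => ∑ u, ∑ v, ind (G.Adj u v) * bd (G := G) K a u v) ≤
      Real.sqrt (PE p (fun K => ((cl (G := G) K a).card : ℝ) ^ 2) *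
        (p * (1 - p) * (Ω * chi G a p))) := by
  apply Real.le_sqrt_of_sq_le
  have hA : p * PE p (fun K => ∑ u, ∑ v, ind (G.Adj u v) * bd (G := G) K a u v) ≤
      PE p (fun K => ((cl (G := G) K a).card : ℝ) *
        ∑ e : G.edgeSet, ind (touch K a e) * Ye p K e) := by
    simp only [dart_edge, Finset.mul_sum]
    rw [PE_sum, PE_sum, Finset.mul_sum]
    exact Finset.sum_le_sum fun e _ => edge_bd h0 h1 a e
  have hB := PE_sq_le h0 h1 (fun K => ((cl (G := G) K a).card : ℝ))
    (fun K => ∑ e : G.edgeSet, ind (touch K a e) * Ye p K e)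
  have hn : 0 ≤ p * PE p (fun K => ∑ u, ∑ v, ind (G.Adj u v) * bd (G := G) K a u v) :=
    mul_nonneg h0 (PE_nonneg h0 h1 fun K => Finset.sum_nonneg fun _ _ => Finset.sum_nonneg
      fun _ _ => mul_nonneg (ind_nonneg _) (bd_nonneg _ _ _ _))
  refine (pow_le_pow_left₀ hn hA 2).trans (hB.trans ?_)
  exact mul_le_mul_of_nonneg_left (ET2 h0 h1 hΩ a) (PE_nonneg h0 h1 fun K => by positivity)

lemma three_pt {p : ℝ} (h0 : 0 ≤ p) (h1 : p ≤ 1) (a u w : V) :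
    PE p (fun K => ind (Cn (G := G) K a u ∧ Cn K a w)) ≤
      ∑ z, tau G p a z * (tau G p z u * tau G p z w) := by
  have key : ∀ K : Finset G.edgeSet, ind (Cn (G := G) K a u ∧ Cn K a w) ≤
      ∑ z, ind (dj (fun K => Cn (G := G) K a z) (dj (fun K => Cn K z u) (fun K => Cn K z w)) K) := by
    intro K
    by_cases h : Cn (G := G) K a u ∧ Cn K a w
    · let pos : Bool → V := fun b => if b then u else w
      have hall : allC (G := G) pos a Finset.univ K := by
        intro i _
        cases i
        · exact h.2
        · exact h.1
      obtain ⟨z, A, -, hA1, hA2, hd⟩ := decomp pos Finset.univ (by simp) K a hall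
      have hcases : ∀ A : Finset Bool, A.Nonempty → A ≠ Finset.univ → 
          (true ∈ A ∧ false ∉ A) ∨ (false ∈ A ∧ true ∉ A) := by decide
      rw [ind_true h]
      have hz : dj (fun K => Cn (G := G) K a z) (dj (fun K => Cn K z u) (fun K => Cn K z w)) K := by
        refine dj_mono (fun _ h => h) ?_ K hd
        intro L hL
        rcases hcases A hA1 hA2 with ⟨ht, hf⟩ | ⟨hf, ht⟩
        · exact dj_mono (fun M hM => hM true ht) (fun M hM => hM false (by simp [hf])) L hL
        · exact dj_mono (fun M hM => hM true (by simp [ht])) (fun M hM => hM false hf) L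
            (dj_comm hL)
      have := Finset.single_le_sum (f := fun z => ind (dj (fun K => Cn (G := G) K a z)
        (dj (fun K => Cn K z u) (fun K => Cn K z w)) K)) (fun _ _ => ind_nonneg _)
        (Finset.mem_univ z)
      simp only [ind_true hz] at this
      exact this
    · rw [ind_false h]; exact Finset.sum_nonneg fun _ _ => ind_nonneg _
  refine (PE_mono h0 h1 key).trans ?_
  rw [PE_sum]
  apply Finset.sum_le_sum
  intro z _
  refine (BK h0 h1 _ _ (Cn_up a z) (dj_up _ _)).trans ?_
  simp only [tau_eq]
  exact mul_le_mul_of_nonneg_left (BK h0 h1 _ _ (Cn_up z u) (Cn_up z w))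
    (PE_nonneg h0 h1 fun K => ind_nonneg _)

lemma lower_pt {p : ℝ} (h0 : 0 ≤ p) (h1 : p ≤ 1) (a u v x : V) :
    tau G p a u * tau G p v x ≤
      PE p (fun K => ind ((Cn (G := G) K a u ∧ ¬ Cn K a v) ∧ Cn K v x)) +
      ∑ w, PE p (fun K => ind (Cn (G := G) K a u ∧ Cn K a w)) * (tau G p v w * tau G p w x) := by
  have e1 : tau G p a u * tau G p v x =
      PE p (fun K => PE p (fun K' => ind (Cn (G := G) K a u) * ind (Cn (G := G) K' v x))) := by
    simp only [PE_mul_left, PE_mul_right, tau_eq]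
  have e2 : PE p (fun K => ind ((Cn (G := G) K a u ∧ ¬ Cn K a v) ∧ Cn K v x)) =
      PE p (fun K => PE p (fun K' : Finset G.edgeSet => ind ((Cn (G := G) K a u ∧ ¬ Cn K a v) ∧
        Cn (mix (tset K a) K K') v x))) := by
    have := PE_swap p (fun K => tset (G := G) K a) (fun K K' => tset_mix)
      (fun K _ => ind ((Cn (G := G) K a u ∧ ¬ Cn K a v) ∧ Cn K v x))
    simp only [PE_const, Cn_mix] at this
    exact this
  have e3 : ∀ w, PE p (fun K => PE p (fun K' : Finset G.edgeSet =>
      ind (Cn (G := G) K a u ∧ Cn K a w) *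
        ind (dj (fun K => Cn K v w) (fun K => Cn K w x) K'))) ≤
      PE p (fun K => ind (Cn (G := G) K a u ∧ Cn K a w)) * (tau G p v w * tau G p w x) := by
    intro w
    simp only [PE_mul_left, PE_mul_right]
    apply mul_le_mul_of_nonneg_left _ (PE_nonneg h0 h1 fun K => ind_nonneg _)
    rw [tau_eq, tau_eq]
    exact BK h0 h1 _ _ (Cn_up v w) (Cn_up w x)
  rw [e1, e2]
  refine le_trans ?_ (add_le_add_right (Finset.sum_le_sum fun w _ => e3 w) _)
  rw [← PE_sum, ← PE_add]
  apply PE_mono h0 h1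
  intro K
  rw [← PE_sum, ← PE_add]
  apply PE_mono h0 h1
  intro K'
  rw [← ind_and]
  by_cases h : Cn (G := G) K a u ∧ Cn (G := G) K' v x
  · rw [ind_true h]
    rcases path_split (fun w => Cn K a w) h.2 with ⟨w, hw, hd⟩ | ⟨hv, hc⟩
    · have := Finset.single_le_sum (f := fun w => ind (Cn (G := G) K a u ∧ Cn K a w) *
        ind (dj (fun K => Cn K v w) (fun K => Cn K w x) K'))
        (fun _ _ => mul_nonneg (ind_nonneg _) (ind_nonneg _)) (Finset.mem_univ w)
      simp only [ind_true hd, ind_true (show Cn (G := G) K a u ∧ Cn K a w from ⟨h.1, hw⟩),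
        mul_one] at this
      linarith [ind_nonneg ((Cn (G := G) K a u ∧ ¬ Cn K a v) ∧ Cn (mix (tset K a) K K') v x)]
    · have hm : Cn (mix (tset K a) K K') v x := by
        refine hc.mono ?_
        intro e he
        rw [Finset.mem_filter] at he
        rw [mem_mix]
        right
        refine ⟨?_, he.1⟩
        rw [mem_tset]
        rintro ⟨w, hw, hcw⟩
        exact he.2 w hw hcw
      rw [ind_true ⟨⟨h.1, hv⟩, hm⟩]
      have : 0 ≤ ∑ w, ind (Cn (G := G) K a u ∧ Cn K a w) *
        ind (dj (fun K => Cn K v w) (fun K => Cn K w x) K') :=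
        Finset.sum_nonneg fun _ _ => mul_nonneg (ind_nonneg _) (ind_nonneg _)
      linarith
  · rw [ind_false h]
    exact add_nonneg (ind_nonneg _)
      (Finset.sum_nonneg fun _ _ => mul_nonneg (ind_nonneg _) (ind_nonneg _))

end graph
end PercAux


namespace PercAux
open Percolation

section graph
variable {V : Type*} [Fintype V] [DecidableEq V] {G : SimpleGraph V}

lemma sum_tau_l (hG : IsTransitive G) (p : ℝ) (x₀ u : V) : ∑ a, tau G p a u = chi G x₀ p := by
  rw [chi_transitive hG p x₀ u, chi_eq_sum]
  exact Finset.sum_congr rfl fun a _ => tau_comm p a u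

lemma sum_tau_r (hG : IsTransitive G) (p : ℝ) (x₀ u : V) : ∑ a, tau G p u a = chi G x₀ p := by
  rw [chi_transitive hG p x₀ u, chi_eq_sum]

lemma lower_uv (hG : IsTransitive G) {p : ℝ} (h0 : 0 ≤ p) (h1 : p ≤ 1) (x₀ u v : V) :
    chi G x₀ p ^ 2 ≤ ∑ a, PE p (fun K => bd (G := G) K a u v) +
      chi G x₀ p ^ 2 * triangle G p u v := by
  set c := chi G x₀ p with hc
  have hc0 : 0 ≤ c := by linarith [one_le_chi (G := G) h0 h1 x₀]
  have hb : ∀ a, PE p (fun K => bd (G := G) K a u v) =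
      ∑ x, PE p (fun K => ind ((Cn (G := G) K a u ∧ ¬ Cn K a v) ∧ Cn K v x)) := by
    intro a
    rw [← PE_sum]
    congr 1; funext K
    rw [bd, cl_card, Finset.mul_sum]
    exact Finset.sum_congr rfl fun x _ => (ind_and _ _).symm
  have step1 : ∀ a, tau G p a u * c ≤ PE p (fun K => bd (G := G) K a u v) +
      ∑ w, ∑ z, tau G p a z * (tau G p z u * tau G p z w * (tau G p v w * c)) := by
    intro a
    have := Finset.sum_le_sum fun x (_ : x ∈ Finset.univ) => lower_pt (G := G) h0 h1 a u v x
    rw [← Finset.mul_sum, sum_tau_r hG p x₀ v, Finset.sum_add_distrib, ← hb a,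
      Finset.sum_comm] at this
    refine this.trans (add_le_add_right (Finset.sum_le_sum fun w _ => ?_) _)
    rw [← Finset.mul_sum, ← Finset.mul_sum, sum_tau_r hG p x₀ w]
    refine (mul_le_mul_of_nonneg_right (three_pt h0 h1 a u w)
      (mul_nonneg (tau_nonneg h0 h1 _ _) hc0)).trans (le_of_eq ?_)
    rw [Finset.sum_mul]
    exact Finset.sum_congr rfl fun z _ => by ring
  have step2 := Finset.sum_le_sum fun a (_ : a ∈ Finset.univ) => step1 a
  rw [← Finset.sum_mul, sum_tau_l hG p x₀ u, Finset.sum_add_distrib] at step2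
  rw [sq]
  refine step2.trans (add_le_add_right (le_of_eq ?_) _)
  have : ∀ a, ∑ w, ∑ z, tau G p a z * (tau G p z u * tau G p z w * (tau G p v w * c)) =
      ∑ z, tau G p a z * ∑ w, (tau G p z u * tau G p z w * (tau G p v w * c)) := by
    intro a
    rw [Finset.sum_comm]
    exact Finset.sum_congr rfl fun z _ => (Finset.mul_sum _ _ _).symm
  simp only [this]
  rw [Finset.sum_comm]
  simp only [← Finset.sum_mul, sum_tau_l hG p x₀]
  rw [triangle, Finset.mul_sum]
  apply Finset.sum_congr rfl; intro z _
  rw [Finset.mul_sum, Finset.mul_sum]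
  apply Finset.sum_congr rfl; intro w _
  rw [tau_comm p z u, tau_comm p v w]; ring

/-- second moment lower bound -/
lemma second_moment (hG : IsTransitive G) {p : ℝ} (h0 : 0 < p) (h1 : p ≤ 1) (x₀ : V) {Ω : ℕ}
    (hΩ0 : 0 < Ω) (hΩ : ∀ u, ∑ v, ind (G.Adj u v) = (Ω : ℝ)) {a₀ : ℝ} (ha1 : a₀ ≤ 1)
    (htri : ∀ x y : V, triangle G p x y ≤ kron x y + a₀) :
    (1 - a₀) ^ 2 * (p * Ω) * chi G x₀ p ^ 3 ≤
      PE p (fun K => ((cl (G := G) K x₀).card : ℝ) ^ 2) := by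
  set c := chi G x₀ p with hc
  have hc1 : 1 ≤ c := one_le_chi (G := G) h0.le h1 x₀
  set M := PE p (fun K => ((cl (G := G) K x₀).card : ℝ) ^ 2) with hM
  have hΩ' : (0 : ℝ) < Ω := by exact_mod_cast hΩ0
  have hV : (0 : ℝ) < Fintype.card V := by
    have : 0 < Fintype.card V := Fintype.card_pos_iff.2 ⟨x₀⟩
    exact_mod_cast this
  have hM0 : 0 ≤ M := PE_nonneg h0.le h1 fun K => by positivity
  have hS : ∀ a, p * PE p (fun K => ∑ u, ∑ v, ind (G.Adj u v) * bd (G := G) K a u v) ≤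
      Real.sqrt (M * (p * (1 - p) * (Ω * c))) := by
    intro a
    have := S_le (G := G) h0.le h1 hΩ a
    rwa [chi_transitive hG p a x₀, PE_cl_transitive hG p (fun n => (n : ℝ) ^ 2) a x₀] at this
  have hsum := Finset.sum_le_sum fun a (_ : a ∈ Finset.univ) => hS a
  rw [Finset.sum_const, Finset.card_univ, nsmul_eq_mul, ← Finset.mul_sum] at hsum
  have hlow : (Fintype.card V : ℝ) * (Ω * (c ^ 2 * (1 - a₀))) ≤
      ∑ a, PE p (fun K => ∑ u, ∑ v, ind (G.Adj u v) * bd (G := G) K a u v) := by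
    simp only [PE_sum, PE_mul_left]
    rw [Finset.sum_comm]
    have : ∀ u, (Ω : ℝ) * (c ^ 2 * (1 - a₀)) ≤
        ∑ a, ∑ v, ind (G.Adj u v) * PE p (fun K => bd (G := G) K a u v) := by
      intro u
      rw [← hΩ u, Finset.sum_mul, Finset.sum_comm]
      apply Finset.sum_le_sum
      intro v _
      rw [← Finset.mul_sum]
      by_cases h : G.Adj u v
      · rw [ind_true h, one_mul, one_mul]
        have l1 := lower_uv hG h0.le h1 x₀ u v
        have l2 := htri u v
        rw [kron, if_neg h.ne, zero_add] at l2
        have l3 := mul_le_mul_of_nonneg_left l2 (sq_nonneg c)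
        linarith
      · rw [ind_false h]; simp
    have := Finset.sum_le_sum fun u (_ : u ∈ Finset.univ) => this u
    rwa [Finset.sum_const, Finset.card_univ, nsmul_eq_mul] at this
  have h3 : p * ((Ω : ℝ) * (c ^ 2 * (1 - a₀))) ≤ Real.sqrt (M * (p * (1 - p) * (Ω * c))) := by
    have := (mul_le_mul_of_nonneg_left hlow h0.le).trans hsum
    have h4 : (Fintype.card V : ℝ) * (p * ((Ω : ℝ) * (c ^ 2 * (1 - a₀)))) ≤
      (Fintype.card V : ℝ) * Real.sqrt (M * (p * (1 - p) * (Ω * c))) := by linarith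
    exact le_of_mul_le_mul_left h4 hV
  have hq : 0 ≤ 1 - a₀ := by linarith
  have h5 := pow_le_pow_left₀ (by positivity) h3 2
  rw [Real.sq_sqrt (mul_nonneg hM0 (mul_nonneg (mul_nonneg h0.le (by linarith)) (by positivity)))]
    at h5
  have h6 : M * (p * (1 - p) * (Ω * c)) ≤ M * (p * 1 * (Ω * c)) := by
    gcongr; linarith
  have h7 := h5.trans h6
  have hpos : 0 < p * Ω * c := by positivity
  refine le_of_mul_le_mul_left ?_ hpos
  nlinarith [h7]

lemma chi_step (hG : IsTransitive G) {p : ℝ} (h0 : 0 ≤ p) (h1 : p ≤ 1) (x₀ : V) {Ω : ℕ}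
    (hΩ : ∀ u, ∑ v, ind (G.Adj u v) = (Ω : ℝ)) :
    chi G x₀ p ≤ 1 + Ω * p * chi G x₀ p := by
  have key : ∀ y, ∀ K : Finset G.edgeSet, ind (Cn K x₀ y) ≤ ind (x₀ = y) +
      ∑ v, ∑ e : G.edgeSet, ind (e.1 = s(x₀, v)) * (ind (e ∈ K) * ind (Cn (K.erase e) v y)) := by
    intro y K
    by_cases h : Cn K x₀ y
    · rw [ind_true h]
      rcases first_step h with rfl | ⟨v, hv, he, hc⟩
      · rw [ind_true rfl]
        have : 0 ≤ ∑ v, ∑ e : G.edgeSet, ind (e.1 = s(x₀, v)) *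
          (ind (e ∈ K) * ind (Cn (K.erase e) v x₀)) :=
          Finset.sum_nonneg fun _ _ => Finset.sum_nonneg fun _ _ =>
            mul_nonneg (ind_nonneg _) (mul_nonneg (ind_nonneg _) (ind_nonneg _))
        linarith
      · have l1 := Finset.single_le_sum (f := fun v => ∑ e : G.edgeSet, ind (e.1 = s(x₀, v)) *
          (ind (e ∈ K) * ind (Cn (K.erase e) v y))) (fun _ _ => Finset.sum_nonneg fun _ _ =>
            mul_nonneg (ind_nonneg _) (mul_nonneg (ind_nonneg _) (ind_nonneg _)))
            (Finset.mem_univ v)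
        have l2 := Finset.single_le_sum (f := fun e : G.edgeSet => ind (e.1 = s(x₀, v)) *
          (ind (e ∈ K) * ind (Cn (K.erase e) v y))) (fun _ _ =>
            mul_nonneg (ind_nonneg _) (mul_nonneg (ind_nonneg _) (ind_nonneg _)))
            (Finset.mem_univ (⟨s(x₀, v), hv⟩ : G.edgeSet))
        simp only [ind_true he, ind_true hc] at l1 l2
        rw [ind_true trivial] at l2
        linarith [ind_nonneg (x₀ = y)]
    · rw [ind_false h]
      exact add_nonneg (ind_nonneg _) (Finset.sum_nonneg fun _ _ => Finset.sum_nonneg fun _ _ =>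
            mul_nonneg (ind_nonneg _) (mul_nonneg (ind_nonneg _) (ind_nonneg _)))
  have edge : ∀ (e : G.edgeSet) (v y : V),
      PE p (fun K => ind (e ∈ K) * ind (Cn (G := G) (K.erase e) v y)) ≤ p * tau G p v y := by
    intro e v y
    rw [PE_resample p e, tau_eq, ← PE_mul_left]
    apply PE_mono h0 h1
    intro K
    rw [ind_true (Finset.mem_insert_self _ _), ind_false (Finset.notMem_erase e K)]
    have : ind (Cn ((insert e K).erase e) v y) ≤ ind (Cn K v y) :=
      ind_mono fun h => h.mono (by intro x; simp)
    nlinarith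
  have step : ∀ y, tau G p x₀ y ≤ ind (x₀ = y) + ∑ v, ind (G.Adj x₀ v) * (p * tau G p v y) := by
    intro y
    rw [tau_eq]
    refine (PE_mono h0 h1 (key y)).trans ?_
    rw [PE_add, PE_const, PE_sum]
    apply add_le_add_right
    apply Finset.sum_le_sum; intro v _
    rw [PE_sum, ← sum_edge_ind (G := G)]
    apply Finset.sum_le_sum; intro e _
    rw [PE_mul_left]
    exact mul_le_mul_of_nonneg_left (edge e v y) (ind_nonneg _)
  have := Finset.sum_le_sum fun y (_ : y ∈ Finset.univ) => step y
  rw [← chi_eq_sum, Finset.sum_add_distrib, Finset.sum_comm] at this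
  have e1 : ∑ y, ind (x₀ = y) = 1 := by
    rw [Finset.sum_eq_single x₀ (fun y _ hy => ind_false (Ne.symm hy))
      (fun h => absurd (Finset.mem_univ _) h), ind_true rfl]
  rw [e1] at this
  refine this.trans (le_of_eq ?_)
  congr 1
  simp only [← Finset.mul_sum, sum_tau_r hG p x₀]
  rw [← Finset.sum_mul, hΩ]; ring

end graph
end PercAux


namespace PercAux
open Percolation

lemma poly_bound {y : ℝ} (hy : 0 ≤ y) :
    0.88 * y ^ 2 - 0.024 * y ^ 3 - 0.0032 * y ^ 4 - 0.00032 * y ^ 5 ≤ 23 := by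
  have h3 : 1.5 * 7.2 * y ^ 2 - 0.5 * 7.2 ^ 3 ≤ y ^ 3 := by
    nlinarith [mul_nonneg (by linarith : 0 ≤ 2 * y + 7.2) (sq_nonneg (y - 7.2))]
  have h4 : 2 * 7.2 ^ 2 * y ^ 2 - 7.2 ^ 4 ≤ y ^ 4 := by
    nlinarith [sq_nonneg (y ^ 2 - 7.2 ^ 2)]
  have h5 : 2.5 * 7.2 ^ 3 * y ^ 2 - 1.5 * 7.2 ^ 5 ≤ y ^ 5 := by
    have : 0 ≤ (2 * y ^ 3 + 4 * 7.2 * y ^ 2 + 6 * 7.2 ^ 2 * y + 3 * 7.2 ^ 3) * (y - 7.2) ^ 2 := by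
      positivity
    nlinarith [this]
  nlinarith [sq_nonneg y]

lemma exp4 {x : ℝ} (hx : 0 ≤ x) : 1 + x + x ^ 2 / 2 + x ^ 3 / 6 + x ^ 4 / 24 ≤ Real.exp x := by
  have := Real.sum_le_exp_of_nonneg hx 5
  simp only [Finset.sum_range_succ, Finset.sum_range_zero, Nat.factorial] at this
  norm_num at this
  linarith

lemma ptwise {y : ℝ} (hy : 0 ≤ y) :
    y ^ 2 - 0.3 * (y * Real.exp (0.4 * y) - y) - y / 16 ≤ 23 * ind (1 / 16 ≤ y) := by
  have he := exp4 (x := 0.4 * y) (by positivity)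
  have hm := mul_le_mul_of_nonneg_left he hy
  by_cases h : 1 / 16 ≤ y
  · rw [ind_true h]
    have := poly_bound hy
    nlinarith
  · rw [ind_false h]
    push Not at h
    have : y * 1 ≤ y * Real.exp (0.4 * y) := by
      apply mul_le_mul_of_nonneg_left _ hy
      exact Real.one_le_exp (by positivity)
    nlinarith

section graph
variable {V : Type*} [Fintype V] [DecidableEq V] {G : SimpleGraph V}

lemma tau_mono_p {p q : ℝ} (h0 : 0 ≤ p) (hpq : p ≤ q) (h1 : q ≤ 1) (x y : V) :
    tau G p x y ≤ tau G q x y := by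
  rw [tau_eq, tau_eq]
  exact PE_mono_p h0 hpq h1 _ (fun K L h => ind_mono fun hc => hc.mono h)

lemma chi_mono_p {p q : ℝ} (h0 : 0 ≤ p) (hpq : p ≤ q) (h1 : q ≤ 1) (x : V) :
    chi G x p ≤ chi G x q := by
  rw [chi_eq_sum, chi_eq_sum]
  exact Finset.sum_le_sum fun y _ => tau_mono_p h0 hpq h1 x y

lemma tri_mono_p {p q : ℝ} (h0 : 0 ≤ p) (hpq : p ≤ q) (h1 : q ≤ 1) (x y : V) :
    triangle G p x y ≤ triangle G q x y := by
  apply Finset.sum_le_sum; intro u _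
  apply Finset.sum_le_sum; intro v _
  have a1 := tau_mono_p (G := G) h0 hpq h1 x u
  have a2 := tau_mono_p (G := G) h0 hpq h1 u v
  have a3 := tau_mono_p (G := G) h0 hpq h1 v y
  have b1 := tau_nonneg (G := G) h0 (hpq.trans h1) x u
  have b2 := tau_nonneg (G := G) h0 (hpq.trans h1) u v
  have b3 := tau_nonneg (G := G) h0 (hpq.trans h1) v y
  exact mul_le_mul (mul_le_mul a1 a2 b2 (b1.trans a1)) a3 b3
    (mul_nonneg (b1.trans a1) (b2.trans a2))

lemma chi_cont (x : V) : Continuous (fun p => chi G x p) := by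
  simp only [chi_eq, PE_eq]
  apply continuous_finsetSum
  intro K _
  apply Continuous.mul _ continuous_const
  unfold wtS
  apply continuous_finsetProd
  intro e _
  split_ifs
  · exact continuous_id
  · exact continuous_const.sub continuous_id

/-- cluster tail -/
def Pk (G : SimpleGraph V) (x₀ : V) (p k : ℝ) : ℝ :=
  PE p (fun K => ind (k ≤ ((cl (G := G) K x₀).card : ℝ)))

lemma tail_lower (hG : IsTransitive G) {p : ℝ} (h0 : 0 ≤ p) (h1 : p ≤ 1) (x₀ : V) {Ω : ℕ}
    (hΩ : ∀ u, ∑ v, ind (G.Adj u v) = (Ω : ℝ)) {a₀ : ℝ} (ha : a₀ ≤ 1 / 1000)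
    (htri : ∀ x y : V, triangle G p x y ≤ kron x y + a₀) {k : ℝ} (hk : 1 ≤ k)
    (hk2 : 3600 * k ≤ chi G x₀ p ^ 2) : 1 ≤ 360 * Real.sqrt k * Pk G x₀ p k := by
  have hs1 : 1 ≤ Real.sqrt k := Real.one_le_sqrt.2 hk
  have hsk : Real.sqrt k ^ 2 = k := Real.sq_sqrt (by linarith)
  have hχ1 := one_le_chi (G := G) h0 h1 x₀
  have hle : 4 * Real.sqrt k ≤ chi G x₀ p := by
    nlinarith
  have hz : chi G x₀ 0 ≤ 1 := by
    have := chi_step (G := G) hG le_rfl zero_le_one x₀ hΩ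
    linarith
  obtain ⟨p', ⟨hp0, hpp⟩, hχ'⟩ := intermediate_value_Icc h0 (chi_cont (G := G) x₀).continuousOn
    (show 4 * Real.sqrt k ∈ _ from ⟨by linarith, hle⟩)
  simp only at hχ'
  have hp1 : p' ≤ 1 := hpp.trans h1
  have hmono : Pk G x₀ p' k ≤ Pk G x₀ p k := by
    refine PE_mono_p hp0 hpp h1 _ (fun K L h => ind_mono fun hc => hc.trans ?_)
    exact_mod_cast Finset.card_le_card (cl_mono h x₀)
  suffices h : 1 ≤ 360 * Real.sqrt k * Pk G x₀ p' k from
    h.trans (mul_le_mul_of_nonneg_left hmono (by positivity))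
  set X := chi G x₀ p' with hX
  have hX4 : 4 ≤ X := by rw [hχ']; linarith
  have hstep := chi_step (G := G) hG hp0 hp1 x₀ hΩ
  rw [← hX] at hstep
  have hΩp : 3 / 4 ≤ p' * Ω := by
    by_contra hcon
    push Not at hcon
    nlinarith
  have hΩ0 : 0 < Ω := by
    rcases Nat.eq_zero_or_pos Ω with h | h
    · rw [h] at hΩp; norm_num at hΩp
    · exact h
  have hp'0 : 0 < p' := by
    rcases hp0.eq_or_lt with h | h
    · rw [← h] at hΩp; norm_num at hΩp
    · exact h
  have hM := second_moment (G := G) hG hp'0 hp1 x₀ hΩ0 hΩ (by linarith : a₀ ≤ 1)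
    (fun x y => (tri_mono_p hp0 hpp h1 x y).trans (htri x y))
  rw [← hX] at hM
  set M := PE p' (fun K => ((cl (G := G) K x₀).card : ℝ) ^ 2) with hMdef
  have hM2 : 0.748 * X ^ 3 ≤ M := by
    refine le_trans ?_ hM
    have : 0.748 ≤ (1 - a₀) ^ 2 * (p' * Ω) := by
      have : 0.998 ≤ (1 - a₀) ^ 2 := by nlinarith
      nlinarith
    gcongr
  have hA : 0 < X ^ 2 := by positivity
  have hE := exp_bound (G := G) hG hp0 hp1 x₀ (t := 0.4 / X ^ 2) (by positivity) (by
    rw [← hX]; field_simp; norm_num)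
  rw [← hX] at hE
  have he5 : 1 - 2 * (0.4 / X ^ 2) * X ^ 2 = 1 / 5 := by field_simp; norm_num
  rw [he5] at hE
  have hsq5 : X / Real.sqrt (1 / 5) ≤ 2.2361 * X := by
    rw [div_le_iff₀ (Real.sqrt_pos.2 (by norm_num))]
    have : (1 : ℝ) / 2.2361 ≤ Real.sqrt (1 / 5) := by
      apply Real.le_sqrt_of_sq_le; norm_num
    have : (1 : ℝ) ≤ 2.2361 * Real.sqrt (1 / 5) := by
      have := mul_le_mul_of_nonneg_left this (by norm_num : (0 : ℝ) ≤ 2.2361)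
      norm_num at this ⊢; linarith
    nlinarith
  have hE2 := hE.trans hsq5
  have hP : PE p' (fun K => (1 / X ^ 2) ^ 2 * ((cl (G := G) K x₀).card : ℝ) ^ 2 -
      (0.3 * (1 / X ^ 2) * (((cl (G := G) K x₀).card : ℝ) *
        Real.exp (0.4 / X ^ 2 * (cl (G := G) K x₀).card)) -
      (0.3 - 1 / 16) * (1 / X ^ 2) * ((cl (G := G) K x₀).card : ℝ))) ≤
      PE p' (fun K => 23 * ind (k ≤ ((cl (G := G) K x₀).card : ℝ))) := by
    apply PE_mono hp0 hp1
    intro K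
    have := ptwise (y := ((cl (G := G) K x₀).card : ℝ) / X ^ 2) (by positivity)
    have hi : ind (1 / 16 ≤ ((cl (G := G) K x₀).card : ℝ) / X ^ 2) =
        ind (k ≤ ((cl (G := G) K x₀).card : ℝ)) := by
      apply ind_congr
      rw [le_div_iff₀ hA, hχ']
      have : 1 / 16 * (4 * Real.sqrt k) ^ 2 = k := by rw [mul_pow, hsk]; ring
      rw [this]
    rw [hi] at this
    refine le_trans (le_of_eq ?_) this
    have : 0.4 * (((cl (G := G) K x₀).card : ℝ) / X ^ 2) =
      0.4 / X ^ 2 * (cl (G := G) K x₀).card := by ring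
    rw [this]
    ring
  rw [PE_sub, PE_sub, PE_mul_left, PE_mul_left, PE_mul_left, PE_mul_left, ← chi_eq, ← hX, ← hMdef]
    at hP
  change _ ≤ 23 * Pk G x₀ p' k at hP
  have hfin : 0.313 / X ≤ 23 * Pk G x₀ p' k := by
    refine le_trans ?_ hP
    have t1 : 0.748 / X ≤ (1 / X ^ 2) ^ 2 * M := by
      calc 0.748 / X = (1 / X ^ 2) ^ 2 * (0.748 * X ^ 3) := by field_simp
        _ ≤ _ := by gcongr
    have t2 := mul_le_mul_of_nonneg_left hE2 (by positivity : 0 ≤ 0.3 * (1 / X ^ 2))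
    have t3 : 0.3 * (1 / X ^ 2) * (2.2361 * X) = 0.67083 / X := by field_simp; norm_num
    have t4 : (0.3 - 1 / 16) * (1 / X ^ 2) * X = 0.2375 / X := by field_simp; norm_num
    rw [t3] at t2
    rw [t4]
    have t5 : 0.313 / X ≤ 0.748 / X - (0.67083 / X - 0.2375 / X) := by
      rw [← sub_div, ← sub_div]; gcongr; norm_num
    linarith
  rw [div_le_iff₀ (by linarith), hχ'] at hfin
  linarith

end graph
end PercAux


namespace PercAux
open Percolation

section graph
variable {V : Type*} [Fintype V] [DecidableEq V] {G : SimpleGraph V}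

/-- maximal cluster size -/
def mx (K : Finset G.edgeSet) : ℕ := maxCluster G (cfg K)

lemma le_mx (K : Finset G.edgeSet) (x : V) : (cl K x).card ≤ mx K :=
  Finset.le_sup (f := fun x => (cluster G (cfg K) x).card) (Finset.mem_univ x)

lemma mx_eq (K : Finset G.edgeSet) (x₀ : V) : ∃ x, (cl K x).card = mx K := by
  obtain ⟨x, -, hx⟩ := Finset.exists_mem_eq_sup Finset.univ ⟨x₀, Finset.mem_univ _⟩
    (fun x => (cluster G (cfg K) x).card)
  exact ⟨x, hx.symm⟩

lemma one_le_mx (K : Finset G.edgeSet) (x₀ : V) : 1 ≤ mx K := (cl_pos K x₀).trans (le_mx K x₀)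

lemma mx_exp (K : Finset G.edgeSet) (x₀ : V) (t : ℝ) :
    (mx K : ℝ) ^ 2 * Real.exp (t * mx K) ≤
      ∑ x, ((cl K x).card : ℝ) * Real.exp (t * (cl K x).card) := by
  obtain ⟨x, hx⟩ := mx_eq K x₀
  have h : ∑ y ∈ cl K x, ((cl K y).card : ℝ) * Real.exp (t * (cl K y).card) =
      (mx K : ℝ) ^ 2 * Real.exp (t * mx K) := by
    rw [Finset.sum_congr rfl (g := fun _ => (mx K : ℝ) * Real.exp (t * mx K))]
    · rw [Finset.sum_const, hx, nsmul_eq_mul]; ring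
    · intro y hy
      rw [← cl_eq (mem_cl.1 hy), hx]
  rw [← h]
  exact Finset.sum_le_sum_of_subset_of_nonneg (Finset.subset_univ _) fun _ _ _ => by positivity

lemma mx_exp_PE (hG : IsTransitive G) {p : ℝ} (h0 : 0 ≤ p) (h1 : p ≤ 1) (x₀ : V) {ℓ : ℝ}
    (hℓ : 1 / 2 ≤ ℓ) :
    PE p (fun K => (mx (G := G) K : ℝ) ^ 2 *
      Real.exp ((1 / (2 * chi G x₀ p ^ 2)) * (1 - 1 / (2 * ℓ)) * mx K)) ≤
      Fintype.card V * (chi G x₀ p * Real.sqrt (2 * ℓ)) := by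
  set X := chi G x₀ p with hX
  have hX1 : 1 ≤ X := one_le_chi h0 h1 x₀
  set t := (1 / (2 * X ^ 2)) * (1 - 1 / (2 * ℓ)) with ht
  have ht0 : 0 ≤ t := by
    have : 1 / (2 * ℓ) ≤ 1 := by rw [div_le_one (by linarith)]; linarith
    have : 0 ≤ 1 - 1 / (2 * ℓ) := by linarith
    positivity
  have hℓ0 : 0 < ℓ := by linarith
  have h2t : 1 - 2 * t * X ^ 2 = 1 / (2 * ℓ) := by
    rw [ht]; field_simp; ring
  have hb : ∀ x, PE p (fun K => ((cl (G := G) K x).card : ℝ) *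
      Real.exp (t * (cl (G := G) K x).card)) ≤ X * Real.sqrt (2 * ℓ) := by
    intro x
    have hxx : chi G x p = X := chi_transitive hG p x x₀
    have hlt : 2 * t * chi G x p ^ 2 < 1 := by
      rw [hxx]
      have : 0 < 1 / (2 * ℓ) := by positivity
      linarith
    have := exp_bound hG h0 h1 x ht0 hlt
    rwa [hxx, h2t, Real.sqrt_div zero_le_one, Real.sqrt_one, div_div_eq_mul_div, div_one] at this
  refine (PE_mono h0 h1 (fun K => mx_exp K x₀ t)).trans ?_
  rw [PE_sum]
  refine (Finset.sum_le_sum fun x _ => hb x).trans ?_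
  rw [Finset.sum_const, Finset.card_univ, nsmul_eq_mul]

lemma part2 (hG : IsTransitive G) {p : ℝ} (h0 : 0 ≤ p) (h1 : p ≤ 1) (x₀ : V)
    (hL : 3 ≤ Real.log ((Fintype.card V : ℝ) / chi G x₀ p ^ 3)) :
    1 - Real.sqrt (Real.exp 1) /
      (2 * Real.log ((Fintype.card V : ℝ) / chi G x₀ p ^ 3)) ^ ((3 : ℝ) / 2) ≤
    PE p (fun K => ind ((mx (G := G) K : ℝ) ≤ 2 * chi G x₀ p ^ 2 *
      Real.log ((Fintype.card V : ℝ) / chi G x₀ p ^ 3))) := by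
  set X := chi G x₀ p with hX
  set L := Real.log ((Fintype.card V : ℝ) / X ^ 3) with hLdef
  have hX1 : 1 ≤ X := one_le_chi h0 h1 x₀
  have hV : (0 : ℝ) < Fintype.card V := by
    have : 0 < Fintype.card V := Fintype.card_pos_iff.2 ⟨x₀⟩
    exact_mod_cast this
  have hexp : Real.exp L = Fintype.card V / X ^ 3 := Real.exp_log (by positivity)
  have hmain := mx_exp_PE hG h0 h1 x₀ (ℓ := L) (by linarith)
  rw [← hX] at hmain
  set t := (1 / (2 * X ^ 2)) * (1 - 1 / (2 * L)) with ht
  have ht0 : 0 ≤ t := by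
    have : 1 / (2 * L) ≤ 1 := by rw [div_le_one (by linarith)]; linarith
    have : 0 ≤ 1 - 1 / (2 * L) := by linarith
    positivity
  set k := 2 * X ^ 2 * L with hk
  have hk0 : 0 < k := by positivity
  have htk : t * k = L - 1 / 2 := by rw [ht, hk]; field_simp
  have hpt : ∀ K : Finset G.edgeSet,
      (k ^ 2 * Real.exp (t * k)) * (1 - ind ((mx (G := G) K : ℝ) ≤ k)) ≤
      (mx (G := G) K : ℝ) ^ 2 * Real.exp (t * mx K) := by
    intro K
    by_cases h : (mx (G := G) K : ℝ) ≤ k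
    · rw [ind_true h, sub_self, mul_zero]; positivity
    · rw [ind_false h, sub_zero, mul_one]
      push Not at h
      gcongr
  have h2 := (PE_mono h0 h1 hpt).trans hmain
  rw [PE_mul_left, PE_sub, PE_const, htk] at h2
  set Q := PE p (fun K => ind ((mx (G := G) K : ℝ) ≤ k)) with hQ
  have h3 : 1 - Q ≤ Real.sqrt (Real.exp 1) / (2 * L) ^ ((3 : ℝ) / 2) := by
    have hr : (2 * L) ^ ((3 : ℝ) / 2) = (2 * L) * Real.sqrt (2 * L) := by
      rw [show (3 : ℝ) / 2 = 1 + 1 / 2 by norm_num, Real.rpow_add (by linarith), Real.rpow_one,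
        Real.sqrt_eq_rpow]
    have he : Real.exp (L - 1 / 2) = Fintype.card V / X ^ 3 / Real.sqrt (Real.exp 1) := by
      rw [Real.exp_sub, hexp, ← Real.exp_half]
    have hs : 0 < Real.sqrt (Real.exp 1) := Real.sqrt_pos.2 (Real.exp_pos _)
    have hl : 0 < Real.sqrt (2 * L) := Real.sqrt_pos.2 (by linarith)
    have hl2 : Real.sqrt (2 * L) ^ 2 = 2 * L := Real.sq_sqrt (by linarith)
    rw [he, hk] at h2
    rw [hr, le_div_iff₀ (by positivity)]
    have h4 : (2 * X ^ 2 * L) ^ 2 * (↑(Fintype.card V) / X ^ 3 / Real.sqrt (Real.exp 1)) * (1 - Q) =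
        (Fintype.card V * X * Real.sqrt (2 * L) / Real.sqrt (Real.exp 1)) *
          ((1 - Q) * (2 * L * Real.sqrt (2 * L))) := by
      field_simp
      rw [hl2]; ring
    have h5 : (Fintype.card V : ℝ) * (X * Real.sqrt (2 * L)) =
        (Fintype.card V * X * Real.sqrt (2 * L) / Real.sqrt (Real.exp 1)) *
          Real.sqrt (Real.exp 1) := by
      field_simp
    rw [h4, h5] at h2
    exact le_of_mul_le_mul_left h2 (by positivity)
  linarith

lemma part1u (hG : IsTransitive G) {p : ℝ} (h0 : 0 ≤ p) (h1 : p ≤ 1) (x₀ : V)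
    (hL : 3 ≤ Real.log ((Fintype.card V : ℝ) / chi G x₀ p ^ 3)) :
    PE p (fun K => (mx (G := G) K : ℝ)) ≤ 2 * chi G x₀ p ^ 2 *
      Real.log ((Fintype.card V : ℝ) / chi G x₀ p ^ 3) := by
  set X := chi G x₀ p with hX
  set L := Real.log ((Fintype.card V : ℝ) / X ^ 3) with hLdef
  have hX1 : 1 ≤ X := one_le_chi h0 h1 x₀
  have hV : (0 : ℝ) < Fintype.card V := by
    have : 0 < Fintype.card V := Fintype.card_pos_iff.2 ⟨x₀⟩
    exact_mod_cast this
  have hexp : Real.exp L = Fintype.card V / X ^ 3 := Real.exp_log (by positivity)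
  obtain ⟨ℓ, hℓ⟩ : ∃ ℓ, L = ℓ + 1 := ⟨L - 1, by ring⟩
  have hℓ2 : 2 ≤ ℓ := by linarith
  have hmain := mx_exp_PE hG h0 h1 x₀ (ℓ := ℓ) (by linarith)
  rw [← hX] at hmain
  set t := (1 / (2 * X ^ 2)) * (1 - 1 / (2 * ℓ)) with ht
  have ht' : t = (2 * ℓ - 1) / (4 * X ^ 2 * ℓ) := by rw [ht]; field_simp; ring
  have hm1 : 0 < 2 * ℓ - 1 := by linarith
  have ht0 : 0 < t := by rw [ht']; positivity
  set k := 2 * X ^ 2 * ℓ with hk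
  have hk0 : 0 < k := by positivity
  have htk : t * k = ℓ - 1 / 2 := by rw [ht, hk]; field_simp
  have hpt : ∀ K : Finset G.edgeSet, (mx (G := G) K : ℝ) ≤
      k + (Real.exp (-(t * k) - 1) / (k ^ 2 * t)) *
        ((mx (G := G) K : ℝ) ^ 2 * Real.exp (t * mx K)) := by
    intro K
    set y := (mx (G := G) K : ℝ) with hy
    have hy0 : 0 ≤ y := by positivity
    by_cases h : y ≤ k
    · have : 0 ≤ (Real.exp (-(t * k) - 1) / (k ^ 2 * t)) * (y ^ 2 * Real.exp (t * y)) := by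
        positivity
      linarith
    · push Not at h
      have e1 : (Real.exp (-(t * k) - 1) / (k ^ 2 * t)) * (y ^ 2 * Real.exp (t * y)) =
          (y / k) ^ 2 * (Real.exp (t * (y - k) - 1) / t) := by
        have : Real.exp (t * (y - k) - 1) = Real.exp (-(t * k) - 1) * Real.exp (t * y) := by
          rw [← Real.exp_add]; congr 1; ring
        rw [this]; field_simp
      rw [e1]
      have e2 : y - k ≤ Real.exp (t * (y - k) - 1) / t := by
        rw [le_div_iff₀ ht0]
        have := Real.add_one_le_exp (t * (y - k) - 1)
        linarith
      have e3 : 1 ≤ (y / k) ^ 2 := by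
        have : 1 ≤ y / k := by rw [le_div_iff₀ hk0]; linarith
        nlinarith
      have e4 : 0 ≤ Real.exp (t * (y - k) - 1) / t := by positivity
      nlinarith
  have h2 := PE_mono h0 h1 hpt
  rw [PE_add, PE_const, PE_mul_left] at h2
  have h3 := mul_le_mul_of_nonneg_left hmain
    (by positivity : 0 ≤ Real.exp (-(t * k) - 1) / (k ^ 2 * t))
  have he : Real.exp (-(t * k) - 1) = Real.sqrt (Real.exp 1) * X ^ 3 / Fintype.card V := by
    have : -(t * k) - 1 = 1 / 2 - L := by rw [htk, hℓ]; ring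
    rw [this, Real.exp_sub, hexp, ← Real.exp_half]
    field_simp
  have hl : 0 < Real.sqrt (2 * ℓ) := Real.sqrt_pos.2 (by linarith)
  have hl2 : Real.sqrt (2 * ℓ) ^ 2 = 2 * ℓ := Real.sq_sqrt (by linarith)
  have hval : Real.exp (-(t * k) - 1) / (k ^ 2 * t) *
      ((Fintype.card V : ℝ) * (X * Real.sqrt (2 * ℓ))) =
      2 * X ^ 2 * (Real.sqrt (Real.exp 1) / (Real.sqrt (2 * ℓ) * (2 * ℓ - 1))) := by
    rw [he, ht', hk]
    field_simp
    rw [hl2]; ring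
  have hsm : Real.sqrt (Real.exp 1) / (Real.sqrt (2 * ℓ) * (2 * ℓ - 1)) ≤ 1 := by
    rw [div_le_one (by positivity)]
    have a1 : Real.sqrt (Real.exp 1) ≤ 2 := by
      rw [Real.sqrt_le_iff]
      exact ⟨by norm_num, by have := Real.exp_one_lt_d9; linarith⟩
    have a2 : 2 ≤ Real.sqrt (2 * ℓ) := by
      apply Real.le_sqrt_of_sq_le; linarith
    nlinarith
  rw [hval] at h3
  have h4 := mul_le_mul_of_nonneg_left hsm (by positivity : 0 ≤ 2 * X ^ 2)
  rw [hℓ]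
  linarith

lemma two_tail (hG : IsTransitive G) {p : ℝ} (h0 : 0 ≤ p) (h1 : p ≤ 1) (x₀ : V) (k : ℝ) (x y : V) :
    PE p (fun K => ind (k ≤ ((cl (G := G) K x).card : ℝ)) *
      ind (k ≤ ((cl (G := G) K y).card : ℝ))) ≤ tau G p x y + Pk G x₀ p k ^ 2 := by
  have hup : ∀ x, Up (fun K : Finset G.edgeSet => k ≤ ((cl (G := G) K x).card : ℝ)) := by
    intro x K L h hK
    exact hK.trans (by exact_mod_cast Finset.card_le_card (cl_mono h x))
  have hpt : ∀ K : Finset G.edgeSet, ind (k ≤ ((cl (G := G) K x).card : ℝ)) *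
      ind (k ≤ ((cl (G := G) K y).card : ℝ)) ≤ ind (Cn K x y) +
      ind (dj (fun K : Finset G.edgeSet => k ≤ ((cl (G := G) K x).card : ℝ))
        (fun K => k ≤ ((cl (G := G) K y).card : ℝ)) K) := by
    intro K
    rw [← ind_and]
    by_cases h : k ≤ ((cl (G := G) K x).card : ℝ) ∧ k ≤ ((cl (G := G) K y).card : ℝ)
    · rw [ind_true h]
      by_cases hc : Cn K x y
      · rw [ind_true hc]; linarith [ind_nonneg (dj (fun K : Finset G.edgeSet =>
          k ≤ ((cl (G := G) K x).card : ℝ)) (fun K => k ≤ ((cl (G := G) K y).card : ℝ)) K)]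
      · rw [ind_false hc, ind_true, zero_add]
        have hl : ∀ x, cl K x ⊆ cl (K ∩ tset K x) x := fun x z hz =>
          mem_cl.2 (Cn_local (mem_cl.1 hz))
        refine ⟨K ∩ tset K x, K ∩ tset K y, Finset.inter_subset_left, Finset.inter_subset_left,
          tset_disj hc, h.1.trans ?_, h.2.trans ?_⟩
        · exact_mod_cast Finset.card_le_card (hl x)
        · exact_mod_cast Finset.card_le_card (hl y)
    · rw [ind_false h]; exact add_nonneg (ind_nonneg _) (ind_nonneg _)
  refine (PE_mono h0 h1 hpt).trans ?_
  rw [PE_add, ← tau_eq]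
  refine add_le_add_right ((BK h0 h1 _ _ (hup x) (hup y)).trans (le_of_eq ?_)) _
  rw [PE_cl_transitive hG p (fun n => ind (k ≤ (n : ℝ))) x x₀,
    PE_cl_transitive hG p (fun n => ind (k ≤ (n : ℝ))) y x₀, sq]
  rfl

lemma second_method (hG : IsTransitive G) {p : ℝ} (h0 : 0 ≤ p) (h1 : p ≤ 1) (x₀ : V) (k : ℝ) :
    ((Fintype.card V : ℝ) * Pk G x₀ p k) ^ 2 ≤
      ((Fintype.card V : ℝ) * chi G x₀ p + ((Fintype.card V : ℝ) * Pk G x₀ p k) ^ 2) *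
        PE p (fun K => ind (k ≤ (mx (G := G) K : ℝ))) := by
  have hZ : PE p (fun K => ∑ x, ind (k ≤ ((cl (G := G) K x).card : ℝ))) =
      (Fintype.card V : ℝ) * Pk G x₀ p k := by
    rw [PE_sum, Finset.sum_congr rfl (g := fun _ => Pk G x₀ p k)]
    · rw [Finset.sum_const, Finset.card_univ, nsmul_eq_mul]
    · intro x _
      exact PE_cl_transitive hG p (fun n => ind (k ≤ (n : ℝ))) x x₀
  have hZ2 : PE p (fun K => (∑ x, ind (k ≤ ((cl (G := G) K x).card : ℝ))) ^ 2) ≤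
      (Fintype.card V : ℝ) * chi G x₀ p + ((Fintype.card V : ℝ) * Pk G x₀ p k) ^ 2 := by
    simp only [sq, Finset.sum_mul_sum, PE_sum]
    refine (Finset.sum_le_sum fun x _ => Finset.sum_le_sum fun y _ =>
      two_tail hG h0 h1 x₀ k x y).trans (le_of_eq ?_)
    simp only [Finset.sum_add_distrib, sum_tau_r hG p x₀, Finset.sum_const, Finset.card_univ,
      nsmul_eq_mul]
    ring
  have hcs := PE_sq_le h0 h1 (fun K => ∑ x, ind (k ≤ ((cl (G := G) K x).card : ℝ)))
    (fun K => ind (k ≤ (mx (G := G) K : ℝ)))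
  have e1 : ∀ K : Finset G.edgeSet, (∑ x, ind (k ≤ ((cl (G := G) K x).card : ℝ))) *
      ind (k ≤ (mx (G := G) K : ℝ)) = ∑ x, ind (k ≤ ((cl (G := G) K x).card : ℝ)) := by
    intro K
    by_cases h : k ≤ (mx (G := G) K : ℝ)
    · rw [ind_true h, mul_one]
    · rw [ind_false h, mul_zero]
      symm
      apply Finset.sum_eq_zero
      intro x _
      apply ind_false
      intro hx
      exact h (hx.trans (by exact_mod_cast le_mx K x))
  have e2 : ∀ P : Prop, ind P ^ 2 = ind P := by
    intro P; rw [sq, ← ind_and]; exact ind_congr (and_self_iff)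
  simp only [e1, e2] at hcs
  rw [hZ] at hcs
  exact hcs.trans (mul_le_mul_of_nonneg_right hZ2 (PE_nonneg h0 h1 fun K => ind_nonneg _))

lemma part3 (hG : IsTransitive G) {p : ℝ} (h0 : 0 ≤ p) (h1 : p ≤ 1) (x₀ : V) {Ω : ℕ}
    (hΩ : ∀ u, ∑ v, ind (G.Adj u v) = (Ω : ℝ)) {a₀ : ℝ} (ha : a₀ ≤ 1 / 1000)
    (htri : ∀ x y : V, triangle G p x y ≤ kron x y + a₀) {w : ℝ} (hw : 1 ≤ w) :
    (1 + 36 * chi G x₀ p ^ 3 / (w * (Fintype.card V : ℝ)))⁻¹ ≤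
      PE p (fun K => ind (chi G x₀ p ^ 2 / (3600 * w) ≤ (mx (G := G) K : ℝ))) := by
  set X := chi G x₀ p with hX
  have hX1 : 1 ≤ X := one_le_chi h0 h1 x₀
  have hV : (0 : ℝ) < Fintype.card V := by
    have : 0 < Fintype.card V := Fintype.card_pos_iff.2 ⟨x₀⟩
    exact_mod_cast this
  set k := X ^ 2 / (3600 * w) with hk
  have hr : 0 ≤ 36 * X ^ 3 / (w * (Fintype.card V : ℝ)) := by positivity
  by_cases hk1 : k ≤ 1
  · have : ∀ K : Finset G.edgeSet, ind (k ≤ (mx (G := G) K : ℝ)) = 1 := fun K =>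
      ind_true (hk1.trans (by exact_mod_cast one_le_mx K x₀))
    simp only [this, PE_const]
    exact inv_le_one_of_one_le₀ (by linarith)
  · push Not at hk1
    have htail := tail_lower hG h0 h1 x₀ hΩ ha htri hk1.le (by
      rw [← hX, hk]
      rw [show 3600 * (X ^ 2 / (3600 * w)) = X ^ 2 / w by field_simp]
      exact div_le_self (by positivity) hw)
    have hsm := second_method hG h0 h1 x₀ k
    rw [← hX] at hsm
    set P := Pk G x₀ p k with hP
    set Q := PE p (fun K => ind (k ≤ (mx (G := G) K : ℝ))) with hQ
    have hQ0 : 0 ≤ Q := PE_nonneg h0 h1 fun K => ind_nonneg _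
    have hP0 : 0 < P := by
      by_contra hcon
      push Not at hcon
      have : 360 * Real.sqrt k * P ≤ 0 := mul_nonpos_of_nonneg_of_nonpos (by positivity) hcon
      linarith
    have h2 : 1 ≤ 36 * X ^ 2 * P ^ 2 / w := by
      have h3 : 1 ≤ (360 * Real.sqrt k * P) ^ 2 := by nlinarith
      have h4 : (360 * Real.sqrt k * P) ^ 2 = 36 * X ^ 2 * P ^ 2 / w := by
        rw [mul_pow, mul_pow, Real.sq_sqrt (by linarith), hk]; field_simp; norm_num
      rwa [h4] at h3
    rw [inv_le_iff_one_le_mul₀ (by linarith)]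
    have h5 : (Fintype.card V : ℝ) * X ≤ ((Fintype.card V : ℝ) * P) ^ 2 *
        (36 * X ^ 3 / (w * (Fintype.card V : ℝ))) := by
      have : ((Fintype.card V : ℝ) * P) ^ 2 * (36 * X ^ 3 / (w * (Fintype.card V : ℝ))) =
        (Fintype.card V : ℝ) * X * (36 * X ^ 2 * P ^ 2 / w) := by field_simp
      rw [this]
      exact le_mul_of_one_le_right (by positivity) h2
    have h6 := mul_le_mul_of_nonneg_right h5 hQ0
    have hpos : 0 < ((Fintype.card V : ℝ) * P) ^ 2 := by positivity
    refine le_of_mul_le_mul_left ?_ hpos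
    nlinarith

lemma part1l {p : ℝ} (h0 : 0 ≤ p) (h1 : p ≤ 1) (X r : ℝ) (hr0 : 0 ≤ r) (hr : 36 * r ≤ 1)
    (h3 : (1 + 36 * r)⁻¹ ≤ PE p (fun K => ind (X ^ 2 / (3600 * 1) ≤ (mx (G := G) K : ℝ)))) :
    ((10 : ℝ) ^ 4)⁻¹ * X ^ 2 ≤ PE p (fun K => (mx (G := G) K : ℝ)) := by
  have hpt : ∀ K : Finset G.edgeSet, (X ^ 2 / (3600 * 1)) *
      ind (X ^ 2 / (3600 * 1) ≤ (mx (G := G) K : ℝ)) ≤ (mx (G := G) K : ℝ) := by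
    intro K
    by_cases h : X ^ 2 / (3600 * 1) ≤ (mx (G := G) K : ℝ)
    · rw [ind_true h, mul_one]; exact h
    · rw [ind_false h, mul_zero]; positivity
  have h2 := PE_mono h0 h1 hpt
  rw [PE_mul_left] at h2
  refine le_trans ?_ h2
  have h4 : (1 / 2 : ℝ) ≤ (1 + 36 * r)⁻¹ := by
    rw [le_inv_comm₀ (by norm_num) (by linarith)]; norm_num; linarith
  have h5 := mul_le_mul_of_nonneg_left (h4.trans h3) (by positivity : 0 ≤ X ^ 2 / (3600 * 1))
  refine le_trans ?_ h5
  have := sq_nonneg X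
  norm_num
  linarith

lemma tri_sum (hG : IsTransitive G) (p : ℝ) (x₀ : V) : ∑ y, triangle G p x₀ y = chi G x₀ p ^ 3 := by
  simp only [triangle]
  rw [Finset.sum_comm]
  have : ∀ u, ∑ y, ∑ v, tau G p x₀ u * tau G p u v * tau G p v y =
      tau G p x₀ u * chi G x₀ p ^ 2 := by
    intro u
    rw [Finset.sum_comm]
    simp only [← Finset.mul_sum, sum_tau_r hG p x₀]
    rw [← Finset.sum_mul, ← Finset.mul_sum, sum_tau_r hG p x₀]; ring
  simp only [this]
  rw [← Finset.sum_mul, sum_tau_r hG p x₀]; ring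

end graph
end PercAux

open Percolation PercAux in
/-- Theorem 1.2 (Subcritical phase): bounds on the largest subcritical cluster. -/
theorem subcritical_phase_largest_cluster :
    ∃ b₀ : ℝ, 0 < b₀ ∧
      ∀ (V : Type) [Fintype V] [DecidableEq V]
        (G : SimpleGraph V) [DecidableRel G.Adj],
        G.Connected → IsTransitive G →
        ∀ Ω : ℕ, G.IsRegularOfDegree Ω →
        ∀ (x₀ : V) (lam : ℝ), 0 < lam →
        1 < lam * (Fintype.card V : ℝ) ^ ((1 : ℝ) / 3) →
        lam * (Fintype.card V : ℝ) ^ ((1 : ℝ) / 3) < (Fintype.card V : ℝ) →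
        b₀⁻¹ ≤ lam * (Fintype.card V : ℝ) ^ ((1 : ℝ) / 3) →
        ∀ pc : ℝ, 0 < pc → pc < 1 →
        chi G x₀ pc = lam * (Fintype.card V : ℝ) ^ ((1 : ℝ) / 3) →
        ∀ a₀ : ℝ, a₀ ≤ b₀ →
        (∀ x y : V, triangle G pc x y ≤ kron x y + a₀) →
        ∀ ε : ℝ, 0 ≤ ε →
        ∀ p : ℝ, p = pc - (Ω : ℝ)⁻¹ * ε → 0 ≤ p →
        (((10 : ℝ) ^ 4)⁻¹ * chi G x₀ p ^ 2 ≤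
            expect G p (fun ω => (maxCluster G ω : ℝ)) ∧
          expect G p (fun ω => (maxCluster G ω : ℝ)) ≤
            2 * chi G x₀ p ^ 2 *
              Real.log ((Fintype.card V : ℝ) / chi G x₀ p ^ 3)) ∧
        (prob G p (fun ω => (maxCluster G ω : ℝ) ≤
              2 * chi G x₀ p ^ 2 *
                Real.log ((Fintype.card V : ℝ) / chi G x₀ p ^ 3)) ≥
            1 - Real.sqrt (Real.exp 1) /
              (2 * Real.log ((Fintype.card V : ℝ) / chi G x₀ p ^ 3)) ^ ((3 : ℝ) / 2)) ∧
        (∀ w : ℝ, 1 ≤ w →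
          prob G p (fun ω => chi G x₀ p ^ 2 / (3600 * w) ≤ (maxCluster G ω : ℝ)) ≥
            (1 + 36 * chi G x₀ p ^ 3 / (w * (Fintype.card V : ℝ)))⁻¹) := by
  refine ⟨1 / 1000, by norm_num, ?_⟩
  intro V _ _ G _ hconn hG Ω hreg x₀ lam hlam hlam1 hlamV hb pc hpc0 hpc1 hχc a₀ ha htri ε hε p hp h0
  have hppc : p ≤ pc := by
    have : 0 ≤ (Ω : ℝ)⁻¹ * ε := by positivity
    linarith
  have h1 : p ≤ 1 := hppc.trans hpc1.le
  have hΩ : ∀ u, ∑ v, PercAux.ind (G.Adj u v) = (Ω : ℝ) := by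
    intro u
    rw [← hreg u, ← G.card_neighborFinset_eq_degree u, Finset.card_eq_sum_ones]
    push_cast
    rw [← Finset.sum_subset (Finset.subset_univ (G.neighborFinset u))]
    · apply Finset.sum_congr rfl
      intro v hv
      exact ind_true (by simpa using hv)
    · intro v _ hv
      exact ind_false (by simpa using hv)
  have htri' : ∀ x y : V, triangle G p x y ≤ kron x y + a₀ := fun x y =>
    (tri_mono_p h0 hppc hpc1.le x y).trans (htri x y)
  rw [← hχc] at hlam1 hlamV hb
  have hVb : 1 ≤ (Fintype.card V : ℝ) * (1 / 1000) := by
    norm_num at hb ⊢; linarith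
  have hV : (0 : ℝ) < Fintype.card V := by linarith
  have hcube : chi G x₀ pc ^ 3 ≤ Fintype.card V * (1 / 500) := by
    rw [← tri_sum hG pc x₀]
    refine (Finset.sum_le_sum fun y _ => htri x₀ y).trans ?_
    rw [Finset.sum_add_distrib, Finset.sum_const, Finset.card_univ, nsmul_eq_mul]
    have : ∑ y, kron x₀ y = 1 := by
      unfold kron
      rw [Finset.sum_eq_single x₀ (fun y _ hy => if_neg (Ne.symm hy))
        (fun h => absurd (Finset.mem_univ _) h), if_pos rfl]
    rw [this]
    have := mul_le_mul_of_nonneg_left ha hV.le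
    linarith
  have hX1 := one_le_chi (G := G) h0 h1 x₀
  have hcube' : chi G x₀ p ^ 3 ≤ Fintype.card V * (1 / 500) :=
    (pow_le_pow_left₀ (by linarith) (chi_mono_p h0 hppc hpc1.le x₀) 3).trans hcube
  have hL : 3 ≤ Real.log ((Fintype.card V : ℝ) / chi G x₀ p ^ 3) := by
    rw [Real.le_log_iff_exp_le (by positivity), le_div_iff₀ (by positivity)]
    have : Real.exp 3 ≤ 500 := by
      have h3 : Real.exp 3 = Real.exp 1 ^ 3 := by rw [← Real.exp_nat_mul]; norm_num
      rw [h3]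
      have := pow_le_pow_left₀ (Real.exp_pos 1).le Real.exp_one_lt_d9.le 3
      norm_num at this ⊢
      linarith
    have h3 : 0 ≤ chi G x₀ p ^ 3 := by positivity
    nlinarith
  have p3 := fun (w : ℝ) (hw : 1 ≤ w) => part3 hG h0 h1 x₀ hΩ ha htri' hw
  refine ⟨⟨?_, ?_⟩, ?_, ?_⟩
  · rw [expect_eq]
    refine part1l h0 h1 (chi G x₀ p) (chi G x₀ p ^ 3 / Fintype.card V) (by positivity) ?_ ?_
    · have : chi G x₀ p ^ 3 / Fintype.card V ≤ 1 / 500 := by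
        rw [div_le_iff₀ hV]; linarith
      linarith
    · have := p3 1 le_rfl
      rwa [one_mul, mul_div_assoc] at this
  · rw [expect_eq]
    exact part1u hG h0 h1 x₀ hL
  · rw [prob_eq]
    exact part2 hG h0 h1 x₀ hL
  · intro w hw
    rw [prob_eq]
    exact p3 w hw
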